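/- arXiv:1703.10520 — 9 statements merged into one kernel-verified Lean document; each statement's English description precedes it below -/
import Mathlib

section
/- Let d ≤ N be positive integers, let X be a d×N real matrix of full rank d, and let k be a non-negative real number with k ≠ 1. Then X represents a regular matroid if and only if there exists a d×N real matrix X_k such that for every d-element subset I of the column indices: if Δ_I(X) = 0 then Δ_I(X_k) = 0, and otherwise |Δ_I(X_k)| = |Δ_I(X)|^k (real power). -/
/-- The maximal minor of a `d × N` matrix indexed by a `d`-element set `I` of column
indices: the determinant of the square submatrix consisting of the columns in `I`
(taken in increasing order). Junk value `0` if `I.card ≠ d`. -/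
noncomputable def maxMinor {K : Type*} [CommRing K] {d N : ℕ}
    (X : Matrix (Fin d) (Fin N) K) (I : Finset (Fin N)) : K :=
  if h : I.card = d then
    (X.submatrix id (fun j : Fin d => ((I.orderIsoOfFin h) j).val)).det
  else 0

/-- A matrix is totally unimodular if every square submatrix has determinant `0`, `1` or `-1`. -/
def IsTotUnimod {K : Type*} [CommRing K] {d N : ℕ} (A : Matrix (Fin d) (Fin N) K) : Prop :=
  ∀ (k : ℕ) (f : Fin k → Fin d) (g : Fin k → Fin N), Function.Injective f → Function.Injective g →
    (A.submatrix f g).det = 0 ∨ (A.submatrix f g).det = 1 ∨ (A.submatrix f g).det = -1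

/-- A `d × N` matrix of full rank `d` represents a regular matroid if there is a totally
unimodular matrix with the same pattern of vanishing maximal minors. -/
def RepresentsRegular {K : Type*} [CommRing K] {d N : ℕ} (X : Matrix (Fin d) (Fin N) K) : Prop :=
  ∃ A : Matrix (Fin d) (Fin N) K, IsTotUnimod A ∧
    ∀ I : Finset (Fin N), I.card = d → (maxMinor X I = 0 ↔ maxMinor A I = 0)


open Function

/-- Abstract Plücker coordinates with the binary-type vanishing condition. -/
structure IsPl {d N : ℕ} (p : (Fin d → Fin N) → ℝ) : Prop where
  exch : ∀ f g t, p f * p g = ∑ i, p (update f i (g t)) * p (update g t (f i))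
  perm : ∀ f (σ : Equiv.Perm (Fin d)), |p (f ∘ σ)| = |p f|
  inj : ∀ f, p f ≠ 0 → Injective f
  tri : ∀ f i k a b, i ≠ k → p f * p (update (update f i a) k b) =
    p (update f i a) * p (update f k b) - p (update f i b) * p (update f k a)
  star : ∀ f i k a b, i ≠ k → p f = 0 ∨ p (update (update f i a) k b) = 0 ∨
    p (update f i a) = 0 ∨ p (update f k b) = 0 ∨ p (update f i b) = 0 ∨ p (update f k a) = 0

/-- Unit absolute values near `f` for columns in `S`. -/
def NiceAt {d N : ℕ} (p : (Fin d → Fin N) → ℝ) (S : Set (Fin N)) (f : Fin d → Fin N) : Prop :=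
  |p f| = 1 ∧ ∀ i, ∀ j ∈ S, p (update f i j) ≠ 0 → |p (update f i j)| = 1

theorem IsPl.abs_right {d N : ℕ} {p : (Fin d → Fin N) → ℝ} (h : IsPl p) {f i k a b}
    (hik : i ≠ k) (h1 : |p f| = 1) (hz : p (update f i b) * p (update f k a) = 0) :
    |p (update (update f i a) k b)| = |p (update f i a)| * |p (update f k b)| := by
  have := h.tri f i k a b hik
  rw [hz, sub_zero] at this
  rw [← abs_mul, ← this, abs_mul, h1, one_mul]

theorem IsPl.abs_left {d N : ℕ} {p : (Fin d → Fin N) → ℝ} (h : IsPl p) {f i k a b}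
    (hik : i ≠ k) (h1 : |p f| = 1) (hz : p (update f i a) * p (update f k b) = 0) :
    |p (update (update f i a) k b)| = |p (update f i b)| * |p (update f k a)| := by
  have := h.tri f i k a b hik
  rw [hz, zero_sub] at this
  rw [← abs_mul, ← abs_neg (_ * _), ← this, abs_mul, h1, one_mul]

theorem IsPl.quad {d N : ℕ} {p : (Fin d → Fin N) → ℝ} (h : IsPl p) {f i k a b}
    (hik : i ≠ k) (h0 : p f ≠ 0) (h1 : p (update f i a) ≠ 0) (h2 : p (update f k b) ≠ 0)
    (h3 : p (update f i b) ≠ 0) (h4 : p (update f k a) ≠ 0) :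
    p (update (update f i a) k b) = 0 ∧
    |p (update f i a)| * |p (update f k b)| = |p (update f i b)| * |p (update f k a)| := by
  have := h.star f i k a b hik
  have hz : p (update (update f i a) k b) = 0 := by tauto
  refine ⟨hz, ?_⟩
  have := h.tri f i k a b hik
  rw [hz, mul_zero] at this
  rw [← abs_mul, ← abs_mul]
  congr 1
  linarith

theorem NiceAt.ne {d N : ℕ} {p : (Fin d → Fin N) → ℝ} {S f} (h : NiceAt p S f) : p f ≠ 0 := by
  intro h0
  have := h.1
  rw [h0] at this
  simp at this

theorem NiceAt.pivot {d N : ℕ} {p : (Fin d → Fin N) → ℝ} {S f} (hp : IsPl p)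
    (h : NiceAt p S f) {i j} (hj : j ∈ S) (hij : p (update f i j) ≠ 0) :
    NiceAt p S (update f i j) := by
  refine ⟨h.2 i j hj hij, fun k l hl hkl => ?_⟩
  by_cases hik : i = k
  · subst hik
    rw [update_idem] at hkl ⊢
    exact h.2 _ _ hl hkl
  by_cases hz : p (update f i l) * p (update f k j) = 0
  · have := hp.abs_right hik h.1 hz
    have h2 : p (update f k l) ≠ 0 := by
      intro h0
      rw [h0] at this
      simp at this
      exact hkl this
    rw [this, h.2 _ _ hj hij, h.2 _ _ hl h2, one_mul]
  · have h34 := mul_ne_zero_iff.1 hz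
    by_cases h2 : p (update f k l) = 0
    · have := hp.abs_left hik h.1 (a := j) (b := l) (by rw [h2, mul_zero])
      rw [this, h.2 _ _ hl h34.1, h.2 _ _ hj h34.2, one_mul]
    · exact absurd (hp.quad hik h.ne hij h2 h34.1 h34.2).1 hkl

theorem NiceAt.quad {d N : ℕ} {p : (Fin d → Fin N) → ℝ} {S f} (hp : IsPl p)
    (h : NiceAt p S f) {i k j e} (hj : j ∈ S) (hij : p (update f i j) ≠ 0)
    (hkj : p (update f k j) ≠ 0) (hie : p (update f i e) ≠ 0) (hke : p (update f k e) ≠ 0) :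
    |p (update f i e)| = |p (update f k e)| := by
  by_cases hik : i = k
  · rw [hik]
  have := (hp.quad hik h.ne hij hke hie hkj).2
  rw [h.2 _ _ hj hij, h.2 _ _ hj hkj] at this
  linarith

theorem path_lemma {d N : ℕ} {p : (Fin d → Fin N) → ℝ} {S : Set (Fin N)} (hp : IsPl p)
    (e : Fin N) (n : ℕ) : ∀ (f : Fin d → Fin N) (r : ℕ → Fin d) (c : ℕ → Fin N),
    NiceAt p S f → (∀ t < n, c t ∈ S) → (∀ t < n, p (update f (r t) (c t)) ≠ 0) →
    (∀ t < n, p (update f (r (t + 1)) (c t)) ≠ 0) →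
    p (update f (r 0) e) ≠ 0 → p (update f (r n) e) ≠ 0 →
    |p (update f (r 0) e)| = |p (update f (r n) e)| := by
  induction n using Nat.strong_induction_on with
  | _ n ih =>
  intro f r c hf hc h1 h2 h0e hne
  rcases n with _ | n
  · rfl
  by_cases hr : r (n + 1) = r 0
  · rw [hr]
  by_cases hA : p (update f (r (n + 1)) (c 0)) = 0
  swap
  · exact hf.quad hp (hc 0 (by omega)) (h1 0 (by omega)) hA h0e hne
  by_cases hB : ∃ t, 1 ≤ t ∧ t ≤ n ∧ p (update f (r 0) (c t)) ≠ 0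
  · obtain ⟨t, ht1, htn, ht⟩ := hB
    have := ih (n + 1 - t) (by omega) f (fun s => if s = 0 then r 0 else r (t + s))
      (fun s => c (t + s)) hf (fun s hs => hc _ (by omega))
      (fun s hs => by
        rcases s with _ | s
        · simpa using ht
        · simpa using h1 (t + (s + 1)) (by omega))
      (fun s hs => by simpa [add_assoc] using h2 (t + s) (by omega)) (by simpa using h0e)
      (by
        have h3 : n + 1 - t ≠ 0 := by omega
        have h4 : t + (n + 1 - t) = n + 1 := by omega
        simpa [h3, h4] using hne)
    have h3 : n + 1 - t ≠ 0 := by omega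
    have h4 : t + (n + 1 - t) = n + 1 := by omega
    simpa [h3, h4] using this
  push Not at hB
  by_cases hC : p (update f (r 1) e) = 0
  swap
  · rw [hf.quad hp (hc 0 (by omega)) (h1 0 (by omega)) (h2 0 (by omega)) h0e hC]
    exact ih n (by omega) f (fun s => r (s + 1)) (fun s => c (s + 1)) hf
      (fun s hs => hc _ (by omega)) (fun s hs => h1 _ (by omega)) (fun s hs => h2 _ (by omega))
      hC hne
  have hrt : ∀ t, 1 ≤ t → t ≤ n + 1 → r 0 ≠ r t := by
    intro t ht1 htn heq
    rcases Nat.lt_or_ge n t with h | h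
    · have : t = n + 1 := by omega
      subst this
      exact hr heq.symm
    · have := h1 t (by omega)
      rw [← heq] at this
      exact this (hB t ht1 h)
  have hc0 := hc 0 (by omega)
  have h10 : p (update f (r 0) (c 0)) ≠ 0 := h1 0 (by omega)
  have a10 := hf.2 _ _ hc0 h10
  have hf' := hf.pivot hp hc0 h10
  have k1 : |p (update (update f (r 0) (c 0)) (r 1) e)| = |p (update f (r 0) e)| := by
    rw [hp.abs_left (hrt 1 le_rfl (by omega)) hf.1 (by rw [hC, mul_zero]),
      hf.2 _ _ hc0 (h2 0 (by omega)), mul_one]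
  have k2 : |p (update (update f (r 0) (c 0)) (r (n + 1)) e)| = |p (update f (r (n + 1)) e)| := by
    rw [hp.abs_right (hrt (n + 1) (by omega) le_rfl) hf.1 (by rw [hA, mul_zero]), a10, one_mul]
  have k3 : ∀ t s, 1 ≤ t → t ≤ n → 1 ≤ s → s ≤ n + 1 → p (update f (r s) (c t)) ≠ 0 →
      p (update (update f (r 0) (c 0)) (r s) (c t)) ≠ 0 := by
    intro t s ht1 htn hs1 hsn hne
    rw [← abs_ne_zero, hp.abs_right (hrt s hs1 hsn) hf.1 (by rw [hB t ht1 htn, zero_mul]), a10,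
      one_mul]
    exact abs_ne_zero.2 hne
  have := ih n (by omega) (update f (r 0) (c 0)) (fun s => r (s + 1)) (fun s => c (s + 1)) hf'
      (fun s hs => hc _ (by omega))
      (fun s hs => k3 _ _ (by omega) (by omega) (by omega) (by omega) (h1 _ (by omega)))
      (fun s hs => k3 _ _ (by omega) (by omega) (by omega) (by omega) (h2 _ (by omega)))
      (by rw [← abs_ne_zero]; simpa [k1] using h0e)
      (by rw [← abs_ne_zero]; simpa [k2] using hne)
  simp only [zero_add] at this
  rw [k1, k2] at this
  exact this

/-- One-step connection of rows. -/
def RowAdj {d N : ℕ} (p : (Fin d → Fin N) → ℝ) (S : Set (Fin N)) (f : Fin d → Fin N)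
    (i i' : Fin d) : Prop :=
  ∃ c ∈ S, p (update f i c) ≠ 0 ∧ p (update f i' c) ≠ 0

theorem walk_of_gen {d N : ℕ} {p : (Fin d → Fin N) → ℝ} {S : Set (Fin N)} {f} {i i' : Fin d}
    (c₀ : Fin N) (h : Relation.ReflTransGen (RowAdj p S f) i i') :
    ∃ (n : ℕ) (r : ℕ → Fin d) (c : ℕ → Fin N), r 0 = i ∧ r n = i' ∧
    (∀ t < n, c t ∈ S) ∧ (∀ t < n, p (update f (r t) (c t)) ≠ 0) ∧
    (∀ t < n, p (update f (r (t + 1)) (c t)) ≠ 0) := by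
  induction h using Relation.ReflTransGen.head_induction_on with
  | refl => exact ⟨0, fun _ => i', fun _ => c₀, rfl, rfl, by simp, by simp, by simp⟩
  | @head a b h' _ ih =>
    obtain ⟨n, r, c, hr0, hrn, hc, h1, h2⟩ := ih
    obtain ⟨j, hj, hj1, hj2⟩ := h'
    refine ⟨n + 1, fun s => Nat.casesOn s a r, fun s => Nat.casesOn s j c, rfl, hrn, ?_, ?_, ?_⟩
    · rintro (_ | t) ht
      · exact hj
      · exact hc t (by omega)
    · rintro (_ | t) ht
      · exact hj1
      · exact h1 t (by omega)
    · rintro (_ | t) ht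
      · simpa [hr0] using hj2
      · exact h2 t (by omega)

theorem gen_lemma {d N : ℕ} {p : (Fin d → Fin N) → ℝ} {S : Set (Fin N)} (hp : IsPl p) {f}
    (hf : NiceAt p S f) (e : Fin N) {i i' : Fin d}
    (h : Relation.ReflTransGen (RowAdj p S f) i i')
    (hi : p (update f i e) ≠ 0) (hi' : p (update f i' e) ≠ 0) :
    |p (update f i e)| = |p (update f i' e)| := by
  obtain ⟨n, r, c, rfl, rfl, hc, h1, h2⟩ := walk_of_gen e h
  exact path_lemma hp e n f r c hf hc h1 h2 hi hi'

/-- Torus scaling. -/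
def scl {d N : ℕ} (C : ℝ) (t : Fin N → ℝ) (p : (Fin d → Fin N) → ℝ) : (Fin d → Fin N) → ℝ :=
  fun f => C * (∏ i, t (f i)) * p f

theorem prod_upd {d N : ℕ} (t : Fin N → ℝ) (f : Fin d → Fin N) (i : Fin d) (a : Fin N) :
    (∏ s, t (update f i a s)) * t (f i) = (∏ s, t (f s)) * t a := by
  have h1 : ∀ s, t (update f i a s) = update (fun s => t (f s)) i (t a) s := by
    intro s
    by_cases h : s = i
    · subst h; simp
    · simp [h]
  rw [Finset.prod_congr rfl (fun s _ => h1 s), Finset.prod_update_of_mem (Finset.mem_univ i),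
    ← Finset.prod_sdiff (Finset.subset_univ {i}) (f := fun s => t (f s))]
  simp
  ring

theorem IsPl.scl {d N : ℕ} {p : (Fin d → Fin N) → ℝ} (h : IsPl p) {C : ℝ} {t : Fin N → ℝ}
    (hC : 0 < C) (ht : ∀ i, 0 < t i) : IsPl (scl C t p) := by
  have hP : ∀ f : Fin d → Fin N, 0 < ∏ i, t (f i) := fun f => Finset.prod_pos fun i _ => ht _
  have hz : ∀ f, _root_.scl C t p f = 0 ↔ p f = 0 := by
    intro f
    simp [_root_.scl, hC.ne', (hP f).ne']
  refine ⟨?_, ?_, ?_, ?_, ?_⟩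
  · intro f g s
    have : _root_.scl C t p f * _root_.scl C t p g =
      (C * C * (∏ i, t (f i)) * (∏ i, t (g i))) * (p f * p g) := by
        simp only [_root_.scl]; ring
    rw [this, h.exch f g s, Finset.mul_sum]
    refine Finset.sum_congr rfl fun i _ => ?_
    have e1 := prod_upd t f i (g s)
    have e2 := prod_upd t g s (f i)
    have e3 : (∏ k, t (update f i (g s) k)) * (∏ k, t (update g s (f i) k)) =
        (∏ k, t (f k)) * (∏ k, t (g k)) := by
      have h1 := (ht (f i)).ne'
      have h2 := (ht (g s)).ne'
      apply mul_right_cancel₀ (mul_ne_zero h1 h2)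
      linear_combination (∏ k, t (update g s (f i) k)) * t (g s) * e1 + (∏ k, t (f k)) * t (g s) * e2
    simp only [_root_.scl]
    linear_combination (-(C * C * p (update f i (g s)) * p (update g s (f i)))) * e3
  · intro f σ
    simp only [_root_.scl, abs_mul, h.perm]
    congr 3
    exact Equiv.prod_comp σ (fun i => t (f i))
  · intro f hf
    exact h.inj f (by rwa [Ne, ← hz f])
  · intro f i k a b hik
    have e1 := prod_upd t f i a
    have e2 := prod_upd t f k b
    have e3 := prod_upd t f i b
    have e4 := prod_upd t f k a
    have e5 := prod_upd t (update f i a) k b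
    rw [update_of_ne hik.symm] at e5
    have h1 := (ht (f i)).ne'
    have h2 := (ht (f k)).ne'
    have T := h.tri f i k a b hik
    simp only [_root_.scl]
    rw [← eq_div_iff h1] at e1 e3
    rw [← eq_div_iff h2] at e2 e4 e5
    rw [e5, e1, e2, e3, e4]
    field_simp
    linear_combination ((∏ i, t (f i)) ^ 2 * t a * t b) * T
  · intro f i k a b hik
    simp only [hz]
    exact h.star f i k a b hik

theorem scl_scl {d N : ℕ} (C C' : ℝ) (t t' : Fin N → ℝ) (p : (Fin d → Fin N) → ℝ) :
    scl C t (scl C' t' p) = scl (C * C') (fun i => t i * t' i) p := by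
  funext f
  simp only [scl, Finset.prod_mul_distrib]
  ring

theorem step_lemma {d N : ℕ} {p : (Fin d → Fin N) → ℝ} {S : Set (Fin N)} (hp : IsPl p) {f}
    (hf : NiceAt p S f) (e : Fin N) :
    ∃ (C : ℝ) (t : Fin N → ℝ), 0 < C ∧ (∀ i, 0 < t i) ∧ NiceAt (scl C t p) (insert e S) f := by
  classical
  have hself : ∀ i, update f i (f i) = f := fun i => update_eq_self i f
  have hfr : ∀ i i', p (update f i (f i')) ≠ 0 → i = i' := by
    intro i i' h
    by_contra hne
    have := hp.inj _ h (a₁ := i) (a₂ := i') (by simp [update_of_ne (Ne.symm hne)])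
    exact hne this
  by_cases hef : e ∈ Set.range f
  · obtain ⟨i', rfl⟩ := hef
    refine ⟨1, fun _ => 1, one_pos, fun _ => one_pos, ?_⟩
    have : scl 1 (fun _ => (1 : ℝ)) p = p := by
      funext g; simp [scl]
    rw [this]
    refine ⟨hf.1, fun i j hj hne => ?_⟩
    rcases hj with rfl | hj
    · have := hfr _ _ hne
      subst this
      rw [hself]
      exact hf.1
    · exact hf.2 i j hj hne
  by_cases heS : e ∈ S
  · refine ⟨1, fun _ => 1, one_pos, fun _ => one_pos, ?_⟩
    have : scl 1 (fun _ => (1 : ℝ)) p = p := by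
      funext g; simp [scl]
    rw [this, Set.insert_eq_of_mem heS]
    exact hf
  set R := Relation.ReflTransGen (RowAdj p S f) with hR
  have hsymm : ∀ i i', R i i' → R i' i := by
    intro i i' h
    have : Std.Symm (RowAdj p S f) := ⟨fun a b ⟨c, h1, h2, h3⟩ => ⟨c, h1, h3, h2⟩⟩
    exact Relation.ReflTransGen.stdSymm.symm _ _ h
  obtain ⟨α, hαpos, hα1, hα2⟩ : ∃ α : Fin d → ℝ, (∀ i, 0 < α i) ∧
      (∀ i, p (update f i e) ≠ 0 → α i = |p (update f i e)|) ∧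
      (∀ i i', R i i' → α i = α i') := by
    refine ⟨fun i => if h : ∃ i', R i i' ∧ p (update f i' e) ≠ 0 then
      |p (update f h.choose e)| else 1, ?_, ?_, ?_⟩
    · intro i
      dsimp only
      split_ifs with h
      · exact abs_pos.2 h.choose_spec.2
      · exact one_pos
    · intro i hi
      have h : ∃ i', R i i' ∧ p (update f i' e) ≠ 0 := ⟨i, Relation.ReflTransGen.refl, hi⟩
      dsimp only
      rw [dif_pos h]
      exact (gen_lemma hp hf e h.choose_spec.1 hi h.choose_spec.2).symm
    · intro i i' hii
      by_cases h : ∃ i', R i i' ∧ p (update f i' e) ≠ 0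
      · have h' : ∃ i'', R i' i'' ∧ p (update f i'' e) ≠ 0 :=
          ⟨h.choose, (hsymm _ _ hii).trans h.choose_spec.1, h.choose_spec.2⟩
        dsimp only
        rw [dif_pos h, dif_pos h']
        exact gen_lemma hp hf e (((hsymm _ _ h.choose_spec.1).trans hii).trans h'.choose_spec.1)
          h.choose_spec.2 h'.choose_spec.2
      · have h' : ¬ ∃ i'', R i' i'' ∧ p (update f i'' e) ≠ 0 := by
          rintro ⟨i'', h1, h2⟩
          exact h ⟨i'', hii.trans h1, h2⟩
        dsimp only
        rw [dif_neg h, dif_neg h']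
  obtain ⟨t, htpos, hte, htf, htS⟩ : ∃ t : Fin N → ℝ, (∀ j, 0 < t j) ∧ t e = 1 ∧
      (∀ i, t (f i) = α i) ∧ (∀ i, ∀ j ∈ S, p (update f i j) ≠ 0 → t j = α i) := by
    refine ⟨fun j => if j = e then 1 else if h : ∃ i, p (update f i j) ≠ 0 then α h.choose else 1,
      ?_, ?_, ?_, ?_⟩
    · intro j
      dsimp only
      split_ifs with h1 h2
      · exact one_pos
      · exact hαpos _
      · exact one_pos
    · simp
    · intro i
      have h1 : f i ≠ e := fun h => hef ⟨i, h⟩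
      have h2 : ∃ i', p (update f i' (f i)) ≠ 0 := ⟨i, by rw [hself]; exact hf.ne⟩
      dsimp only
      rw [if_neg h1, dif_pos h2, hfr _ _ h2.choose_spec]
    · intro i j hj hij
      have h1 : j ≠ e := fun h => heS (h ▸ hj)
      have h2 : ∃ i', p (update f i' j) ≠ 0 := ⟨i, hij⟩
      dsimp only
      rw [if_neg h1, dif_pos h2]
      exact hα2 _ _ (Relation.ReflTransGen.single ⟨j, hj, h2.choose_spec, hij⟩)
  have hP : 0 < ∏ i, t (f i) := Finset.prod_pos fun i _ => htpos _
  have key : ∀ i j, |scl (∏ i, t (f i))⁻¹ t p (update f i j)| = t j / α i * |p (update f i j)| := by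
    intro i j
    have e1 := prod_upd t f i j
    rw [htf i] at e1
    rw [← eq_div_iff (hαpos i).ne'] at e1
    simp only [scl]
    rw [e1, abs_mul]
    congr 1
    rw [mul_div_assoc, inv_mul_cancel_left₀ hP.ne']
    exact abs_of_pos (div_pos (htpos j) (hαpos i))
  refine ⟨(∏ i, t (f i))⁻¹, t, inv_pos.2 hP, htpos, ?_, ?_⟩
  · simp only [scl]
    rw [inv_mul_cancel₀ hP.ne', one_mul]
    exact hf.1
  · intro i j hj hne
    have hne' : p (update f i j) ≠ 0 := by
      intro h0
      exact hne (by simp [scl, h0])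
    rw [key]
    rcases hj with rfl | hj
    · rw [hte, ← hα1 i hne']
      field_simp [(hαpos i).ne']
    · rw [htS i j hj hne', hf.2 i j hj hne', div_self (hαpos i).ne', one_mul]

theorem scale_lemma {d N : ℕ} {p : (Fin d → Fin N) → ℝ} (hp : IsPl p) {f} (hf : p f ≠ 0)
    (S : Finset (Fin N)) :
    ∃ (C : ℝ) (t : Fin N → ℝ), 0 < C ∧ (∀ i, 0 < t i) ∧ NiceAt (scl C t p) (S : Set (Fin N)) f := by
  induction S using Finset.induction_on with
  | empty =>
    refine ⟨|p f|⁻¹, fun _ => 1, inv_pos.2 (abs_pos.2 hf), fun _ => one_pos, ?_, by simp⟩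
    simp [scl, abs_mul, abs_inv, hf]
  | insert e S _ ih =>
    obtain ⟨C, t, hC, ht, h⟩ := ih
    obtain ⟨C', t', hC', ht', h'⟩ := step_lemma (hp.scl hC ht) h e
    rw [scl_scl] at h'
    refine ⟨_, _, mul_pos hC' hC, fun i => mul_pos (ht' i) (ht i), ?_⟩
    simpa using h'

theorem all_unit {d N : ℕ} {p : (Fin d → Fin N) → ℝ} (hp : IsPl p) (g : Fin d → Fin N)
    (hg : p g ≠ 0) (n : ℕ) : ∀ f, NiceAt p Set.univ f →
    (Finset.univ.filter fun t => g t ∉ Set.range f).card = n → |p g| = 1 := by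
  classical
  induction n using Nat.strong_induction_on with
  | _ n ih =>
  intro f hf hn
  by_cases h : ∃ t, g t ∉ Set.range f
  · obtain ⟨t, ht⟩ := h
    have hs := hp.exch f g t
    have : ∃ i, p (update f i (g t)) * p (update g t (f i)) ≠ 0 := by
      by_contra hcon
      push Not at hcon
      rw [Finset.sum_eq_zero (fun i _ => hcon i)] at hs
      exact mul_ne_zero hf.ne hg hs
    obtain ⟨i, hi⟩ := this
    obtain ⟨h1, h2⟩ := mul_ne_zero_iff.1 hi
    have hfi : ∀ s, g s ≠ f i := by
      intro s hs'
      by_cases hst : s = t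
      · subst hst
        exact ht ⟨i, hs'.symm⟩
      · exact hst (hp.inj _ h2 (by simp [update_of_ne hst, hs']))
    refine ih _ ?_ _ (hf.pivot hp (Set.mem_univ (g t)) h1) rfl
    rw [← hn]
    apply Finset.card_lt_card
    rw [Finset.ssubset_iff_of_subset]
    · refine ⟨t, by simpa using ht, ?_⟩
      simp only [Finset.mem_filter, Finset.mem_univ, true_and, not_not]
      exact ⟨i, by simp⟩
    · intro s
      simp only [Finset.mem_filter, Finset.mem_univ, true_and]
      rintro hs' ⟨k, rfl'⟩
      apply hs'
      refine ⟨k, ?_⟩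
      rw [update_of_ne]
      · exact rfl'
      · rintro rfl
        exact hfi s rfl'.symm
  · push Not at h
    choose σ hσ using h
    have hσi : Injective σ := by
      intro a b hab
      apply hp.inj g hg
      rw [← hσ a, ← hσ b, hab]
    have hb : Bijective σ := (Finite.injective_iff_bijective).1 hσi
    have : g = f ∘ (Equiv.ofBijective σ hb) := by
      funext a; simp [hσ]
    rw [this, hp.perm]
    exact hf.1

theorem core {d N : ℕ} {p : (Fin d → Fin N) → ℝ} (hp : IsPl p) {f} (hf : p f ≠ 0) :
    ∃ (C : ℝ) (t : Fin N → ℝ), 0 < C ∧ (∀ i, 0 < t i) ∧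
      ∀ g, p g ≠ 0 → |p g| = C * ∏ i, t (g i) := by
  obtain ⟨C, t, hC, ht, h⟩ := scale_lemma hp hf Finset.univ
  rw [Finset.coe_univ] at h
  refine ⟨C⁻¹, fun i => (t i)⁻¹, inv_pos.2 hC, fun i => inv_pos.2 (ht i), fun g hg => ?_⟩
  have hP : 0 < ∏ i, t (g i) := Finset.prod_pos fun i _ => ht _
  have hg' : scl C t p g ≠ 0 := by
    simp [scl, hC.ne', hP.ne', hg]
  have := all_unit (hp.scl hC ht) g hg' _ f h rfl
  simp only [scl, abs_mul, abs_of_pos hC, abs_of_pos hP] at this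
  rw [Finset.prod_inv_distrib, ← mul_inv]
  exact eq_inv_of_mul_eq_one_right this

/-- Minor with ordered column choice. -/
noncomputable def pm {d N : ℕ} (X : Matrix (Fin d) (Fin N) ℝ) (f : Fin d → Fin N) : ℝ :=
  (X.submatrix id f).det

theorem pm_update {d N : ℕ} (X : Matrix (Fin d) (Fin N) ℝ) (f : Fin d → Fin N) (i a) :
    pm X (update f i a) = ((X.submatrix id f).updateCol i (fun r => X r a)).det := by
  unfold pm
  congr 1
  ext r s
  by_cases h : s = i
  · subst h; simp
  · simp [h]

theorem pm_inj {d N : ℕ} (X : Matrix (Fin d) (Fin N) ℝ) (f : Fin d → Fin N) (h : pm X f ≠ 0) :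
    Injective f := by
  intro a b hab
  by_contra hne
  exact h (Matrix.det_zero_of_column_eq hne (by simp [hab]))

theorem pm_perm {d N : ℕ} (X : Matrix (Fin d) (Fin N) ℝ) (f : Fin d → Fin N)
    (σ : Equiv.Perm (Fin d)) : pm X (f ∘ σ) = (Equiv.Perm.sign σ : ℤ) * pm X f :=
  Matrix.det_permute' σ (X.submatrix id f)

theorem abs_pm_perm {d N : ℕ} (X : Matrix (Fin d) (Fin N) ℝ) (f : Fin d → Fin N)
    (σ : Equiv.Perm (Fin d)) : |pm X (f ∘ σ)| = |pm X f| := by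
  rw [pm_perm, abs_mul, abs_unit_intCast, one_mul]

theorem det_updateCol_fsum {d : ℕ} (M : Matrix (Fin d) (Fin d) ℝ) (t : Fin d) {ι : Type*}
    (s : Finset ι) (c : ι → ℝ) (v : ι → Fin d → ℝ) :
    (M.updateCol t (∑ i ∈ s, c i • v i)).det = ∑ i ∈ s, c i * (M.updateCol t (v i)).det := by
  have := map_sum (Matrix.cramer M) (fun i => c i • v i) s
  have h2 := congrFun this t
  simpa [Matrix.cramer_apply, Finset.sum_apply] using h2

theorem pm_exch {d N : ℕ} (X : Matrix (Fin d) (Fin N) ℝ) (f g : Fin d → Fin N) (t : Fin d) :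
    pm X f * pm X g = ∑ i, pm X (update f i (g t)) * pm X (update g t (f i)) := by
  have h := Matrix.mulVec_cramer (X.submatrix id f) (fun r => X r (g t))
  have h1 : (∑ i, pm X (update f i (g t)) • (fun r => X r (f i)) : Fin d → ℝ) =
      pm X f • (fun r => X r (g t)) := by
    rw [pm, ← h]
    funext r
    simp [Matrix.mulVec, dotProduct, Matrix.cramer_apply, pm_update, mul_comm]
  have h2 := det_updateCol_fsum (X.submatrix id g) t Finset.univ
    (fun i => pm X (update f i (g t))) (fun i r => X r (f i))
  rw [h1, Matrix.det_updateCol_smul, ← pm_update, update_eq_self] at h2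
  rw [h2]
  simp only [pm_update]

theorem pm_tri {d N : ℕ} (X : Matrix (Fin d) (Fin N) ℝ) (f : Fin d → Fin N) (i k a b)
    (hik : i ≠ k) : pm X f * pm X (update (update f i a) k b) =
    pm X (update f i a) * pm X (update f k b) - pm X (update f i b) * pm X (update f k a) := by
  rw [pm_exch X f (update (update f i a) k b) k]
  simp only [update_self, update_idem]
  rw [Finset.sum_eq_add_of_mem i k (Finset.mem_univ _) (Finset.mem_univ _) hik]
  · have e1 : update (update f i a) k (f k) = update f i a := by
      rw [update_comm hik, update_eq_self]
    have e2 : update (update f i a) k (f i) = update f k a ∘ Equiv.swap i k := by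
      funext s
      by_cases h1 : s = i
      · subst h1; simp [hik]
      · by_cases h2 : s = k
        · subst h2; simp [hik]
        · simp [Equiv.swap_apply_of_ne_of_ne h1 h2, h1, h2]
    rw [e1, e2, pm_perm, Equiv.Perm.sign_swap hik]
    push_cast
    ring
  · intro c _ hc
    have : pm X (update (update f i a) k (f c)) = 0 := by
      by_contra hne
      have := pm_inj X _ hne (a₁ := c) (a₂ := k) (by simp [hc.1, hc.2])
      exact hc.2 this
    rw [this, mul_zero]

theorem isPl_pm {d N : ℕ} (X : Matrix (Fin d) (Fin N) ℝ)
    (star : ∀ f i k a b, i ≠ k → pm X f = 0 ∨ pm X (update (update f i a) k b) = 0 ∨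
    pm X (update f i a) = 0 ∨ pm X (update f k b) = 0 ∨ pm X (update f i b) = 0 ∨
    pm X (update f k a) = 0) : IsPl (pm X) :=
  ⟨pm_exch X, abs_pm_perm X, pm_inj X, pm_tri X, star⟩

theorem exists_maxMinor {d N : ℕ} (f : Fin d → Fin N) (hf : Injective f) :
    ∃ I : Finset (Fin N), I.card = d ∧
      ∀ X : Matrix (Fin d) (Fin N) ℝ, |pm X f| = |maxMinor X I| ∧
        (pm X f = 0 ↔ maxMinor X I = 0) := by
  classical
  have hc : (Finset.univ.image f).card = d := by
    rw [Finset.card_image_of_injective _ hf]; simp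
  refine ⟨Finset.univ.image f, hc, fun X => ?_⟩
  suffices h : |pm X f| = |maxMinor X (Finset.univ.image f)| by
    refine ⟨h, ?_⟩
    rw [← abs_eq_zero, h, abs_eq_zero]
  set o := (Finset.univ.image f).orderIsoOfFin hc
  let σ : Fin d → Fin d := fun i => o.symm ⟨f i, Finset.mem_image_of_mem _ (Finset.mem_univ _)⟩
  have hσ : Injective σ := by
    intro a b hab
    have := o.symm.injective hab
    exact hf (Subtype.mk_eq_mk.1 this)
  have hb : Bijective σ := (Finite.injective_iff_bijective).1 hσ
  have hfe : f = (fun j => (o j).val) ∘ (Equiv.ofBijective σ hb) := by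
    funext a; simp [σ]
  rw [maxMinor, dif_pos hc]
  conv_lhs => rw [hfe]
  rw [abs_pm_perm]
  rfl

theorem maxMinor_eq_pm {d N : ℕ} (I : Finset (Fin N)) (hI : I.card = d) :
    ∃ f : Fin d → Fin N, Injective f ∧
      ∀ X : Matrix (Fin d) (Fin N) ℝ, maxMinor X I = pm X f := by
  refine ⟨fun j => (I.orderIsoOfFin hI j).val, ?_, fun X => ?_⟩
  · exact Subtype.val_injective.comp (I.orderIsoOfFin hI).injective
  · rw [maxMinor, dif_pos hI]; rfl

theorem exists_basis {d N : ℕ} (X : Matrix (Fin d) (Fin N) ℝ) (hX : X.rank = d) :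
    ∃ f, pm X f ≠ 0 := by
  rw [Matrix.rank_eq_finrank_span_cols] at hX
  have H := Submodule.exists_fun_fin_finrank_span_eq ℝ (Set.range X.col)
  rw [hX] at H
  obtain ⟨v, hv, -, hli⟩ := H
  choose c hc using hv
  refine ⟨c, ?_⟩
  have h1 : (X.submatrix id c).col = v := by
    funext i
    rw [← hc i]
    rfl
  rw [← h1, Matrix.linearIndependent_cols_iff_isUnit, Matrix.isUnit_iff_isUnit_det] at hli
  exact hli.ne_zero

theorem rpow_no {k u v w : ℝ} (hk0 : 0 ≤ k) (hk1 : k ≠ 1) (hv : 0 < v) (hw : 0 < w)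
    (h : u = v + w) : u ^ k ≠ v ^ k + w ^ k ∧ v ^ k ≠ u ^ k + w ^ k ∧ w ^ k ≠ u ^ k + v ^ k := by
  have hu : 0 < u := by linarith
  have pu := Real.rpow_pos_of_pos hu k
  have pv := Real.rpow_pos_of_pos hv k
  have pw := Real.rpow_pos_of_pos hw k
  have l1 := Real.rpow_le_rpow hv.le (show v ≤ u by linarith) hk0
  have l2 := Real.rpow_le_rpow hw.le (show w ≤ u by linarith) hk0
  refine ⟨?_, by linarith, by linarith⟩
  have e : ∀ x : ℝ, 0 < x → x ^ k = x * x ^ (k - 1) := by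
    intro x hx
    rw [Real.rpow_sub_one hx.ne']
    field_simp
  rw [e u hu, e v hv, e w hw]
  rcases lt_or_gt_of_ne hk1 with h1 | h1
  · have m1 := Real.rpow_lt_rpow_of_neg hv (show v < u by linarith) (show k - 1 < 0 by linarith)
    have m2 := Real.rpow_lt_rpow_of_neg hw (show w < u by linarith) (show k - 1 < 0 by linarith)
    have := mul_lt_mul_of_pos_left m1 hv
    have := mul_lt_mul_of_pos_left m2 hw
    have : u * u ^ (k - 1) = v * u ^ (k - 1) + w * u ^ (k - 1) := by rw [← add_mul, ← h]
    linarith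
  · have m1 := Real.rpow_lt_rpow hv.le (show v < u by linarith) (show 0 < k - 1 by linarith)
    have m2 := Real.rpow_lt_rpow hw.le (show w < u by linarith) (show 0 < k - 1 by linarith)
    have := mul_lt_mul_of_pos_left m1 hv
    have := mul_lt_mul_of_pos_left m2 hw
    have : u * u ^ (k - 1) = v * u ^ (k - 1) + w * u ^ (k - 1) := by rw [← add_mul, ← h]
    linarith

theorem abs_cases3 {a b c : ℝ} (h : a = b - c) :
    |a| = |b| + |c| ∨ |b| = |a| + |c| ∨ |c| = |a| + |b| := by
  rcases abs_cases a with ⟨h1, _⟩ | ⟨h1, _⟩ <;> rcases abs_cases b with ⟨h2, _⟩ | ⟨h2, _⟩ <;>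
    rcases abs_cases c with ⟨h3, _⟩ | ⟨h3, _⟩ <;> rw [h1, h2, h3] <;>
    first
    | (left; linarith)
    | (right; left; linarith)
    | (right; right; linarith)

theorem no_three {k a b c a' b' c' : ℝ} (hk0 : 0 ≤ k) (hk1 : k ≠ 1) (ha : a ≠ 0) (hb : b ≠ 0)
    (hc : c ≠ 0) (h : a = b - c) (h' : a' = b' - c') (ea : |a'| = |a| ^ k) (eb : |b'| = |b| ^ k)
    (ec : |c'| = |c| ^ k) : False := by
  have pa := abs_pos.2 ha
  have pb := abs_pos.2 hb
  have pc := abs_pos.2 hc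
  have H := abs_cases3 h'
  rw [ea, eb, ec] at H
  rcases abs_cases3 h with h | h | h
  · have := rpow_no hk0 hk1 pb pc h
    grind
  · have := rpow_no hk0 hk1 pa pc h
    grind
  · have := rpow_no hk0 hk1 pa pb h
    grind

theorem star_of_power {d N : ℕ} (X Y : Matrix (Fin d) (Fin N) ℝ) {k : ℝ} (hk0 : 0 ≤ k)
    (hk1 : k ≠ 1) (h : ∀ f, pm X f ≠ 0 → |pm Y f| = |pm X f| ^ k) : IsPl (pm X) := by
  refine isPl_pm X fun f i k a b hik => ?_
  by_contra hcon
  push Not at hcon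
  obtain ⟨h1, h2, h3, h4, h5, h6⟩ := hcon
  refine no_three hk0 hk1 (mul_ne_zero h1 h2) (mul_ne_zero h3 h4) (mul_ne_zero h5 h6)
    (pm_tri X f i k a b hik) (pm_tri Y f i k a b hik) ?_ ?_ ?_ <;>
  simp only [abs_mul] <;> rw [h _ (by assumption), h _ (by assumption),
    Real.mul_rpow (abs_nonneg _) (abs_nonneg _)]

theorem pm_tu {d N : ℕ} {A : Matrix (Fin d) (Fin N) ℝ} (hA : IsTotUnimod A) (f)
    (hf : pm A f ≠ 0) : |pm A f| = 1 := by
  rcases hA d id f injective_id (pm_inj A f hf) with h | h | h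
  · exact absurd h hf
  · unfold pm; rw [h]; simp
  · unfold pm; rw [h]; simp

theorem tu_of_pm {d N : ℕ} {A : Matrix (Fin d) (Fin N) ℝ} (f₀ : Fin d → Fin N)
    (h0 : ∀ r s, A r (f₀ s) = if r = s then 1 else 0)
    (h : ∀ g, pm A g ≠ 0 → |pm A g| = 1) : IsTotUnimod A := by
  classical
  intro k f g hf hg
  let e : Fin k ⊕ {i // i ∉ Set.range f} ≃ Fin d :=
    (Equiv.sumCongr (Equiv.ofInjective f hf) (Equiv.refl _)).trans (Equiv.Set.sumCompl (Set.range f))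
  have e1 : ∀ s, e (Sum.inl s) = f s := fun s => rfl
  have e2 : ∀ s, e (Sum.inr s) = s.1 := fun s => rfl
  let hh : Fin d → Fin N := fun i => Sum.elim g (fun s => f₀ s.1) (e.symm i)
  have hh1 : ∀ s, hh (f s) = g s := fun s => by
    rw [← e1]; simp only [hh, Equiv.symm_apply_apply, Sum.elim_inl]
  have hh2 : ∀ s : {i // i ∉ Set.range f}, hh s.1 = f₀ s.1 := fun s => by
    rw [← e2]; simp only [hh, Equiv.symm_apply_apply, Sum.elim_inr]; rw [e2]
  have hM : (A.submatrix id hh).submatrix e e = Matrix.fromBlocks (A.submatrix f g) 0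
      (A.submatrix (fun s : {i // i ∉ Set.range f} => s.1) g) 1 := by
    ext r s
    rcases r with r | r <;> rcases s with s | s
    · simp [hh1, e1]
    · simp only [Matrix.submatrix_apply, hh, id, Equiv.symm_apply_apply, Sum.elim_inr, e1, h0,
        Matrix.fromBlocks_apply₁₂, Matrix.zero_apply]
      rw [if_neg]
      intro hrs
      exact s.2 ⟨r, hrs⟩
    · simp [hh1, e1, e2]
    · simp [hh2, e2, h0, Matrix.one_apply, Subtype.ext_iff]
  have hd : (A.submatrix f g).det = pm A hh := by
    unfold pm
    rw [← Matrix.det_submatrix_equiv_self e, hM, Matrix.det_fromBlocks_zero₁₂]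
    simp
  rw [hd]
  by_cases hz : pm A hh = 0
  · exact Or.inl hz
  · exact Or.inr (eq_or_eq_neg_of_abs_eq (h hh hz))

theorem pm_scale {d N : ℕ} (L : Matrix (Fin d) (Fin d) ℝ) (X : Matrix (Fin d) (Fin N) ℝ)
    (t : Fin N → ℝ) (g) :
    pm (L * X * Matrix.diagonal t) g = L.det * pm X g * ∏ i, t (g i) := by
  have : (L * X * Matrix.diagonal t).submatrix id g =
      L * X.submatrix id g * Matrix.diagonal (fun i => t (g i)) := by
    ext r s
    rw [Matrix.submatrix_apply, Matrix.mul_diagonal, Matrix.mul_diagonal, Matrix.mul_apply,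
      Matrix.mul_apply]
    rfl
  unfold pm
  rw [this, Matrix.det_mul, Matrix.det_mul, Matrix.det_diagonal]

theorem regular_of_isPl {d N : ℕ} (X : Matrix (Fin d) (Fin N) ℝ) (hX : X.rank = d)
    (hp : IsPl (pm X)) : RepresentsRegular X := by
  obtain ⟨f₀, hf₀⟩ := exists_basis X hX
  obtain ⟨C, t, hC, ht, h⟩ := core hp hf₀
  have hB : IsUnit (X.submatrix id f₀).det := isUnit_iff_ne_zero.2 hf₀
  have hP : ∀ f : Fin d → Fin N, 0 < ∏ i, t (f i) := fun f => Finset.prod_pos fun i _ => ht _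
  set L := Matrix.diagonal (fun i => t (f₀ i)) * (X.submatrix id f₀)⁻¹ with hL
  set A := L * X * Matrix.diagonal (fun j => (t j)⁻¹) with hA
  have hLd : L.det = (∏ i, t (f₀ i)) * (pm X f₀)⁻¹ := by
    rw [hL, Matrix.det_mul, Matrix.det_diagonal, Matrix.det_nonsing_inv, Ring.inverse_eq_inv']
    rfl
  have hpm : ∀ g, pm A g = (∏ i, t (f₀ i)) * (pm X f₀)⁻¹ * pm X g * (∏ i, t (g i))⁻¹ := by
    intro g
    rw [hA, pm_scale, hLd, Finset.prod_inv_distrib]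
  have hz : ∀ g, pm A g = 0 ↔ pm X g = 0 := by
    intro g
    rw [hpm]
    simp [(hP f₀).ne', (hP g).ne', hf₀]
  refine ⟨A, tu_of_pm f₀ ?_ ?_, ?_⟩
  · intro r s
    have h1 : (X.submatrix id f₀)⁻¹ * X.submatrix id f₀ = 1 := Matrix.nonsing_inv_mul _ hB
    have h2 := congrFun (congrFun h1 r) s
    rw [Matrix.mul_apply] at h2
    rw [hA, Matrix.mul_diagonal, hL, Matrix.mul_assoc, Matrix.diagonal_mul, Matrix.mul_apply]
    simp only [Matrix.submatrix_apply, id] at h2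
    rw [h2, Matrix.one_apply]
    split_ifs with hrs
    · subst hrs
      rw [mul_one, mul_inv_cancel₀ (ht _).ne']
    · simp
  · intro g hg
    have hg' : pm X g ≠ 0 := fun h0 => hg ((hz g).2 h0)
    rw [hpm, abs_mul, abs_mul, abs_mul, abs_inv, abs_inv, abs_of_pos (hP f₀), abs_of_pos (hP g),
      h _ hf₀, h _ hg']
    have := (hP f₀).ne'
    have := (hP g).ne'
    field_simp
  · intro I hI
    obtain ⟨f, _, hf⟩ := maxMinor_eq_pm I hI
    rw [hf, hf, hz]

/-- **Theorem 1.1 (real case).** For a full-rank real `d × N` matrix `X` and a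
non-negative real `k ≠ 1`, `X` represents a regular matroid iff there is a matrix `X_k`
whose maximal minors satisfy `|Δ_I(X_k)| = |Δ_I(X)|^k` (with the convention `0^0 = 0`). -/
theorem kth_power_plucker_iff_regular_real (d N : ℕ) (hd : 0 < d) (hdN : d ≤ N)
    (X : Matrix (Fin d) (Fin N) ℝ) (hX : X.rank = d)
    (k : ℝ) (hk0 : 0 ≤ k) (hk1 : k ≠ 1) :
    RepresentsRegular X ↔
      ∃ Xk : Matrix (Fin d) (Fin N) ℝ, ∀ I : Finset (Fin N), I.card = d →
        (maxMinor X I = 0 → maxMinor Xk I = 0) ∧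
        (maxMinor X I ≠ 0 → |maxMinor Xk I| = |maxMinor X I| ^ k) := by
  constructor
  · rintro ⟨A, hA, hs⟩
    have hz : ∀ f, pm X f = 0 ↔ pm A f = 0 := by
      intro f
      by_cases hf : Injective f
      · obtain ⟨I, hI, h⟩ := exists_maxMinor f hf
        rw [(h X).2, (h A).2, hs I hI]
      · have h1 : pm X f = 0 := by
          by_contra h; exact hf (pm_inj X f h)
        have h2 : pm A f = 0 := by
          by_contra h; exact hf (pm_inj A f h)
        simp [h1, h2]
    have hpA : IsPl (pm A) := by
      refine star_of_power A A le_rfl zero_ne_one fun f hf => ?_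
      rw [Real.rpow_zero, pm_tu hA f hf]
    have hp : IsPl (pm X) := by
      refine isPl_pm X ?_
      simp only [hz]
      exact hpA.star
    obtain ⟨f₀, hf₀⟩ := exists_basis X hX
    obtain ⟨C, t, hC, ht, h⟩ := core hp hf₀
    have hP : ∀ f : Fin d → Fin N, 0 < ∏ i, t (f i) := fun f => Finset.prod_pos fun i _ => ht _
    refine ⟨Matrix.diagonal (fun i : Fin d => if i = ⟨0, hd⟩ then C ^ k else 1) * A *
      Matrix.diagonal (fun j => t j ^ k), fun I hI => ?_⟩
    obtain ⟨f, _, hf⟩ := maxMinor_eq_pm I hI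
    rw [hf, hf, pm_scale]
    constructor
    · intro h0
      rw [(hz f).1 h0]
      simp
    · intro h0
      have h0' : pm A f ≠ 0 := fun h' => h0 ((hz f).2 h')
      rw [Matrix.det_diagonal, h _ h0, Finset.prod_ite_eq' Finset.univ, if_pos (Finset.mem_univ _),
        abs_mul, abs_mul, pm_tu hA f h0', Real.mul_rpow hC.le (hP f).le,
        ← Real.finsetProd_rpow _ _ (fun i _ => (ht _).le),
        abs_of_pos (Real.rpow_pos_of_pos hC k), mul_one,
        abs_of_pos (Finset.prod_pos fun i _ => Real.rpow_pos_of_pos (ht _) k)]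
  · rintro ⟨Y, hY⟩
    refine regular_of_isPl X hX (star_of_power X Y hk0 hk1 fun f hf => ?_)
    obtain ⟨I, hI, h⟩ := exists_maxMinor f (pm_inj X f hf)
    rw [(h X).1, (h Y).1]
    exact (hY I hI).2 (fun h0 => hf ((h X).2.2 h0))
end

section
/- Let d ≤ N be positive integers, let X be a d×N real matrix of full rank d that represents a regular matroid, and let k be any real number. Then there exists a d×N real matrix X_k such that for every d-element subset I of the column indices: if Δ_I(X) = 0 then Δ_I(X_k) = 0; otherwise |Δ_I(X_k)| = |Δ_I(X)|^k (real power) and Δ_I(X_k) · Δ_I(X) ≥ 0. -/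
lemma two_sum_aux {p : ℕ} (F : Fin (p+1) → ℝ) (a b : Fin (p+1)) (hab : a ≠ b)
    (h : ∀ s, s ≠ a → s ≠ b → F s = 0) : ∑ s, F s = F a + F b := by
  exact Finset.sum_eq_add a b hab (fun c _ hc => h c hc.1 hc.2) (by simp) (by simp)

/-- cycle parity -/
lemma det_cycle_zero {p : ℕ} (Q : Matrix (Fin (p+1)) (Fin (p+1)) ℝ)
    (hent : ∀ i j, Q i j = 0 ∨ Q i j = 1 ∨ Q i j = -1)
    (hdet : Q.det = 0 ∨ Q.det = 1 ∨ Q.det = -1)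
    (htwo : ∀ j, ∃ a b, a ≠ b ∧ Q a j ≠ 0 ∧ Q b j ≠ 0 ∧ ∀ s, s ≠ a → s ≠ b → Q s j = 0) :
    Q.det = 0 := by
  classical
  have : ∀ i j, ∃ z : ℤ, (z : ℝ) = Q i j := by
    intro i j
    rcases hent i j with h | h | h
    · exact ⟨0, by simp [h]⟩
    · exact ⟨1, by simp [h]⟩
    · exact ⟨-1, by simp [h]⟩
  choose Z hZ using this
  let ZM : Matrix (Fin (p+1)) (Fin (p+1)) ℤ := Matrix.of Z
  have hQ : Q = ZM.map (Int.castRingHom ℝ) := by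
    ext i j; simp [ZM, hZ]
  have hd : Q.det = ((ZM.det : ℤ) : ℝ) := by
    rw [hQ]; exact ((Int.castRingHom ℝ).map_det ZM).symm
  have hmod : ((ZM.det : ℤ) : ZMod 2) = 0 := by
    have : ((ZM.det : ℤ) : ZMod 2) = (ZM.map (Int.castRingHom (ZMod 2))).det :=
      (Int.castRingHom (ZMod 2)).map_det ZM
    rw [this]
    haveI : Fact (Nat.Prime 2) := ⟨Nat.prime_two⟩
    apply Matrix.exists_vecMul_eq_zero_iff.mp
    refine ⟨fun _ => 1, ?_, ?_⟩
    · intro h; have := congrFun h 0; simp at this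
    · ext j
      obtain ⟨a, b, hab, ha, hb, h⟩ := htwo j
      simp only [Matrix.vecMul, dotProduct, one_mul, Pi.zero_apply]
      rw [Finset.sum_eq_add a b hab]
      · have key : ∀ i, Q i j ≠ 0 → ((Z i j : ℤ) : ZMod 2) = 1 := by
          intro i hi
          rcases hent i j with h | h | h
          · exact absurd h hi
          · have : Z i j = 1 := by have := hZ i j; rw [h] at this; exact_mod_cast this
            rw [this]; rfl
          · have : Z i j = -1 := by have := hZ i j; rw [h] at this; exact_mod_cast this
            rw [this]; rfl
        simp only [Matrix.map_apply, ZM, Matrix.of_apply, eq_intCast, key a ha, key b hb]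
        rfl
      · intro c _ hc
        have : Z c j = 0 := by
          have := hZ c j; rw [h c hc.1 hc.2] at this; exact_mod_cast this
        simp [ZM, this]
      · simp
      · simp
  rw [hd] at hdet ⊢
  rcases hdet with h | h | h
  · exact h
  · have : ZM.det = 1 := by exact_mod_cast h
    rw [this] at hmod; exact absurd hmod (by decide)
  · have : ZM.det = -1 := by exact_mod_cast h
    rw [this] at hmod; exact absurd hmod (by decide)

lemma chain_ne {p : ℕ} (y a b : ℕ → ℝ) 
    (hb : ∀ s < p, b s ≠ 0) (hy : ∀ s < p, y s * a s + y (s+1) * b s = 0)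
    (hne : ∃ s ≤ p, y s ≠ 0) : y 0 ≠ 0 := by
  intro h0
  obtain ⟨s, hs, hs'⟩ := hne
  apply hs'
  clear hs'
  induction s with
  | zero => exact h0
  | succ s ih =>
    have := hy s (by omega)
    rw [ih (by omega)] at this
    simpa [hb s (by omega)] using this

lemma chain_prop {p : ℕ} (y z a b : ℕ → ℝ) 
    (hb : ∀ s < p, b s ≠ 0) (hy : ∀ s < p, y s * a s + y (s+1) * b s = 0)
    (hz : ∀ s < p, z s * a s + z (s+1) * b s = 0) (s : ℕ) (hs : s ≤ p) :
    y s * z 0 = z s * y 0 := by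
  induction s with
  | zero => ring
  | succ s ih =>
    have h1 := hy s (by omega)
    have h2 := hz s (by omega)
    have h3 := ih (by omega)
    apply mul_right_cancel₀ (hb s (by omega))
    linear_combination z 0 * h1 - y 0 * h2 - a s * h3

/-- The cycle lemma: path `v 0, ..., v p` of rows, columns `c s` joining `v s, v (s+1)`,
and column `j` joining `v 0` and `v p`. -/
lemma cycle_ratio {d N : ℕ} (M M' : Matrix (Fin d) (Fin N) ℝ)
    (hTU : IsTotUnimod M')
    (hz : ∀ (k : ℕ) (f : Fin k → Fin d) (g : Fin k → Fin N), Function.Injective f →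
      Function.Injective g → ((M.submatrix f g).det = 0 ↔ (M'.submatrix f g).det = 0))
    (r : Fin d → ℝ) (q : Fin N → ℝ) (hr : ∀ i, r i ≠ 0) (hq : ∀ j, q j ≠ 0)
    (p : ℕ) (hp : 0 < p) (v : ℕ → Fin d) (c : ℕ → Fin N) (j : Fin N)
    (hv : ∀ s ≤ p, ∀ t ≤ p, v s = v t → s = t)
    (hc : ∀ s < p, ∀ t ≤ p, (M' (v t) (c s) ≠ 0 ↔ t = s ∨ t = s + 1))
    (hcM : ∀ s < p, ∀ i, M i (c s) = r i * M' i (c s) * q (c s))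
    (hcj : ∀ s < p, c s ≠ j)
    (hj : ∀ t ≤ p, (M' (v t) j ≠ 0 ↔ t = 0 ∨ t = p))
    (hsupp : ∀ i, M i j = 0 ↔ M' i j = 0) :
    M (v 0) j / r (v 0) * M' (v p) j = M (v p) j / r (v p) * M' (v 0) j := by
  classical
  let f : Fin (p+1) → Fin d := fun s => v s
  let g : Fin (p+1) → Fin N := Fin.cases j (fun s => c s)
  have hf : Function.Injective f := by
    intro s t h
    exact Fin.ext (hv s (by omega) t (by omega) h)
  have hcc : ∀ s < p, ∀ t < p, c s = c t → s = t := by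
    intro s hs t ht h
    have h1 := (hc s hs s (by omega)).2 (by simp)
    have h2 := (hc s hs (s+1) (by omega)).2 (by simp)
    rw [h] at h1 h2
    have h3 := (hc t ht s (by omega)).1 h1
    have h4 := (hc t ht (s+1) (by omega)).1 h2
    omega
  have hg : Function.Injective g := by
    intro s t
    refine Fin.cases ?_ (fun s => ?_) s <;> refine Fin.cases ?_ (fun t => ?_) t
    · simp
    · intro h; exact absurd h.symm (hcj t t.2)
    · intro h; exact absurd h (hcj s s.2)
    · intro h
      have : (s : ℕ) = t := hcc s s.2 t t.2 h
      rw [Fin.ext this]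
  have h0 : (M'.submatrix f g).det = 0 := by
    apply det_cycle_zero
    · intro a b
      have := hTU 1 (fun _ => f a) (fun _ => g b) (fun _ _ _ => Subsingleton.elim _ _)
        (fun _ _ _ => Subsingleton.elim _ _)
      simpa using this
    · exact hTU _ f g hf hg
    · intro b
      refine Fin.cases ?_ (fun s => ?_) b
      · refine ⟨0, Fin.last p, ?_, ?_, ?_, ?_⟩
        · intro h; have := congrArg Fin.val h; simp at this; omega
        · exact (hj 0 (by omega)).2 (by simp)
        · exact (hj p le_rfl).2 (by simp)
        · intro s hs1 hs2
          by_contra hne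
          rcases (hj s (by omega)).1 hne with h | h
          · exact hs1 (Fin.ext h)
          · exact hs2 (Fin.ext h)
      · refine ⟨s.castSucc, s.succ, ?_, ?_, ?_, ?_⟩
        · intro h; have := congrArg Fin.val h; simp at this
        · exact (hc s s.2 s (by omega)).2 (by simp)
        · exact (hc s s.2 (s+1) (by omega)).2 (by simp)
        · intro t ht1 ht2
          by_contra hne
          rcases (hc s s.2 t (by omega)).1 hne with h | h
          · exact ht1 (Fin.ext h)
          · exact ht2 (Fin.ext h)
  have h1 := (hz _ f g hf hg).2 h0
  obtain ⟨y, hy0, hy⟩ := Matrix.exists_vecMul_eq_zero_iff.mpr h0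
  obtain ⟨z, hz0, hz⟩ := Matrix.exists_vecMul_eq_zero_iff.mpr h1
  let Y : ℕ → ℝ := fun s => if h : s < p + 1 then y ⟨s, h⟩ else 0
  let Z : ℕ → ℝ := fun s => if h : s < p + 1 then z ⟨s, h⟩ * r (v s) else 0
  have hYv : ∀ s : Fin (p+1), Y s = y s := fun s => dif_pos s.2
  have hZv : ∀ s : Fin (p+1), Z s = z s * r (v s) := fun s => dif_pos s.2
  have hYc : ∀ s < p, Y s * M' (v s) (c s) + Y (s+1) * M' (v (s+1)) (c s) = 0 := by
    intro s hs
    have := congrFun hy (Fin.succ ⟨s, hs⟩)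
    simp only [Matrix.vecMul, dotProduct, Pi.zero_apply, Matrix.submatrix_apply] at this
    rw [two_sum_aux _ (Fin.castSucc ⟨s, hs⟩) (Fin.succ ⟨s, hs⟩)] at this
    · rw [← hYv, ← hYv] at this
      exact this
    · intro h; have := congrArg Fin.val h; simp at this
    · intro t ht1 ht2
      have : M' (v t) (c s) = 0 := by
        by_contra hne
        rcases (hc s hs t (by omega)).1 hne with h | h
        · exact ht1 (Fin.ext h)
        · exact ht2 (Fin.ext h)
      exact mul_eq_zero_of_right _ this
  have hZc : ∀ s < p, Z s * M' (v s) (c s) + Z (s+1) * M' (v (s+1)) (c s) = 0 := by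
    intro s hs
    have := congrFun hz (Fin.succ ⟨s, hs⟩)
    simp only [Matrix.vecMul, dotProduct, Pi.zero_apply, Matrix.submatrix_apply] at this
    rw [two_sum_aux _ (Fin.castSucc ⟨s, hs⟩) (Fin.succ ⟨s, hs⟩)] at this
    · have e1 := hZv (Fin.castSucc ⟨s, hs⟩)
      have e2 := hZv (Fin.succ ⟨s, hs⟩)
      change Z s = _ * r (v s) at e1
      change Z (s+1) = _ * r (v (s+1)) at e2
      rw [e1, e2]
      change _ * M (v s) (c s) + _ * M (v (s+1)) (c s) = 0 at this
      rw [hcM s hs, hcM s hs] at this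
      apply mul_right_cancel₀ (hq (c s))
      linear_combination this
    · intro h; have := congrArg Fin.val h; simp at this
    · intro t ht1 ht2
      have : M' (v t) (c s) = 0 := by
        by_contra hne
        rcases (hc s hs t (by omega)).1 hne with h | h
        · exact ht1 (Fin.ext h)
        · exact ht2 (Fin.ext h)
      have h2 : M (v t) (c s) = 0 := by rw [hcM s hs, this]; ring
      exact mul_eq_zero_of_right _ h2
  have h0p : (0 : Fin (p+1)) ≠ Fin.last p := by
    intro h; have := congrArg Fin.val h; simp at this; omega
  have hjz : ∀ t : Fin (p+1), t ≠ 0 → t ≠ Fin.last p → M' (v t) j = 0 := by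
    intro t h1 h2
    by_contra hne
    rcases (hj t (by omega)).1 hne with h | h
    · exact h1 (Fin.ext h)
    · exact h2 (Fin.ext h)
  have hYj : Y 0 * M' (v 0) j + Y p * M' (v p) j = 0 := by
    have := congrFun hy 0
    simp only [Matrix.vecMul, dotProduct, Pi.zero_apply, Matrix.submatrix_apply] at this
    rw [two_sum_aux _ 0 (Fin.last p) h0p] at this
    · rw [← hYv, ← hYv] at this
      exact this
    · intro t ht1 ht2
      exact mul_eq_zero_of_right _ (hjz t ht1 ht2)
  have hZj : Z 0 * (M (v 0) j / r (v 0)) + Z p * (M (v p) j / r (v p)) = 0 := by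
    have := congrFun hz 0
    simp only [Matrix.vecMul, dotProduct, Pi.zero_apply, Matrix.submatrix_apply] at this
    rw [two_sum_aux _ 0 (Fin.last p) h0p] at this
    · have e1 := hZv 0
      have e2 := hZv (Fin.last p)
      change Z 0 = _ * r (v 0) at e1
      change Z p = _ * r (v p) at e2
      rw [e1, e2, ← this]
      change _ = _ * M (v 0) j + _ * M (v p) j
      have := hr (v 0)
      have := hr (v p)
      field_simp
    · intro t ht1 ht2
      exact mul_eq_zero_of_right _ ((hsupp _).2 (hjz t ht1 ht2))
  have hb : ∀ s < p, M' (v (s+1)) (c s) ≠ 0 := fun s hs => (hc s hs (s+1) (by omega)).2 (by simp)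
  have hY0 : Y 0 ≠ 0 := by
    apply chain_ne Y _ _ hb hYc
    obtain ⟨s, hs⟩ := Function.ne_iff.mp hy0
    exact ⟨s, by omega, by rw [hYv]; exact hs⟩
  have hZ0 : Z 0 ≠ 0 := by
    apply chain_ne Z _ _ hb hZc
    obtain ⟨s, hs⟩ := Function.ne_iff.mp hz0
    exact ⟨s, by omega, by rw [hZv]; exact mul_ne_zero hs (hr _)⟩
  have hpr := chain_prop Y Z _ _ hb hYc hZc p le_rfl
  have e : Z 0 * M' (v 0) j + Z p * M' (v p) j = 0 := by
    apply mul_left_cancel₀ hY0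
    linear_combination Z 0 * hYj - M' (v p) j * hpr
  apply mul_left_cancel₀ hZ0
  linear_combination M' (v p) j * hZj - (M (v p) j / r (v p)) * e

lemma exists_scaling {d N : ℕ} (M M' : Matrix (Fin d) (Fin N) ℝ)
    (hTU : IsTotUnimod M')
    (hz : ∀ (k : ℕ) (f : Fin k → Fin d) (g : Fin k → Fin N), Function.Injective f →
      Function.Injective g → ((M.submatrix f g).det = 0 ↔ (M'.submatrix f g).det = 0))
    (S : Finset (Fin N)) :
    ∃ (r : Fin d → ℝ) (q : Fin N → ℝ), (∀ i, r i ≠ 0) ∧ (∀ j, q j ≠ 0) ∧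
      ∀ j ∈ S, ∀ i, M i j = r i * M' i j * q j := by
  classical
  have hsupp : ∀ i j, M i j = 0 ↔ M' i j = 0 := by
    intro i j
    have := hz 1 (fun _ => i) (fun _ => j) (fun _ _ _ => Subsingleton.elim _ _)
        (fun _ _ _ => Subsingleton.elim _ _)
    simpa using this
  induction S using Finset.induction_on with
  | empty => exact ⟨fun _ => 1, fun _ => 1, by simp, by simp, by simp⟩
  | insert j S hjS ih =>
    obtain ⟨r, q, hr, hq, h⟩ := ih
    let G : SimpleGraph (Fin d) :=
      { Adj := fun a b => a ≠ b ∧ ∃ c ∈ S, M' a c ≠ 0 ∧ M' b c ≠ 0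
        symm := ⟨fun a b ⟨h1, c, hc, h2, h3⟩ => ⟨h1.symm, c, hc, h3, h2⟩⟩
        loopless := ⟨fun a h => h.1 rfl⟩ }
    let ρ : Fin d → ℝ := fun i => M i j / r i / M' i j
    have key : ∀ n a b, G.Reachable a b → G.dist a b = n → M' a j ≠ 0 → M' b j ≠ 0 →
        ρ a = ρ b := by
      intro n
      induction n using Nat.strong_induction_on with
      | _ n IH =>
      intro a b hab hn ha hb
      obtain ⟨w, hw⟩ := hab.exists_walk_length_eq_dist
      rw [hn] at hw
      rcases Nat.eq_zero_or_pos n with h0 | hpos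
      · subst h0
        rw [hab.dist_eq_zero_iff.mp hn]
      let v : ℕ → Fin d := w.getVert
      have hv0 : v 0 = a := w.getVert_zero
      have hvn : v n = b := by rw [← hw]; exact w.getVert_length
      have hra : ∀ s, G.Reachable a (v s) := fun s => ⟨w.take s⟩
      have hrb : ∀ s, G.Reachable (v s) b := fun s => ⟨w.drop s⟩
      have hda : ∀ s ≤ n, G.dist a (v s) ≤ s := fun s hs => by
        have : G.dist a (v s) ≤ _ := SimpleGraph.dist_le (w.take s)
        rw [SimpleGraph.Walk.take_length] at this; omega
      have hdb : ∀ s ≤ n, G.dist (v s) b ≤ n - s := fun s hs => by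
        have : G.dist (v s) b ≤ _ := SimpleGraph.dist_le (w.drop s)
        rw [SimpleGraph.Walk.drop_length] at this; omega
      have htri : ∀ s, n ≤ G.dist a (v s) + G.dist (v s) b := fun s => by
        rw [← hn]; exact (hra s).dist_triangle_left b
      have hdae : ∀ s ≤ n, G.dist a (v s) = s := fun s hs => by
        have := hda s hs; have := hdb s hs; have := htri s; omega
      have hdbe : ∀ s ≤ n, G.dist (v s) b = n - s := fun s hs => by
        have := hda s hs; have := hdb s hs; have := htri s; omega
      have hvinj : ∀ s ≤ n, ∀ t ≤ n, v s = v t → s = t := by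
        intro s hs t ht e
        rw [← hdae s hs, e, hdae t ht]
      have hadj : ∀ s < n, G.Adj (v s) (v (s+1)) := fun s hs =>
        w.adj_getVert_succ (by omega)
      have hadj2 : ∀ s ≤ n, ∀ t ≤ n, G.Adj (v s) (v t) → t ≤ s + 1 := by
        intro s hs t ht e
        have h1 := (hra s).dist_triangle_left (v t)
        rw [hdae s hs, hdae t ht, SimpleGraph.dist_eq_one_iff_adj.mpr e] at h1
        exact h1
      have hex : ∀ s, ∃ c, s < n → c ∈ S ∧ M' (v s) c ≠ 0 ∧ M' (v (s+1)) c ≠ 0 := by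
        intro s
        by_cases hs : s < n
        · obtain ⟨_, c, hc⟩ := hadj s hs
          exact ⟨c, fun _ => hc⟩
        · exact ⟨j, fun h => absurd h hs⟩
      choose c hc using hex
      by_cases hmid : ∃ t, 0 < t ∧ t < n ∧ M' (v t) j ≠ 0
      · obtain ⟨t, ht0, htn, ht⟩ := hmid
        have e1 := IH t htn a (v t) (hra t) (hdae t htn.le) ha ht
        have e2 := IH (n - t) (by omega) (v t) b (hrb t) (hdbe t htn.le) ht hb
        rw [e1, e2]
      · push Not at hmid
        have := cycle_ratio M M' hTU hz r q hr hq n hpos v c j hvinj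
          (by
            intro s hs t ht
            obtain ⟨hcS, h1, h2⟩ := hc s hs
            constructor
            · intro h3
              by_contra hne
              push Not at hne
              have a1 : G.Adj (v s) (v t) :=
                ⟨fun e => hne.1 (hvinj s hs.le t ht e).symm, c s, hcS, h1, h3⟩
              have a2 : G.Adj (v t) (v (s+1)) :=
                ⟨fun e => hne.2 (hvinj t ht (s+1) hs e), c s, hcS, h3, h2⟩
              have := hadj2 s hs.le t ht a1
              have := hadj2 t ht (s+1) hs a2
              omega
            · rintro (rfl | rfl)
              · exact h1
              · exact h2)
          (fun s hs i => h (c s) (hc s hs).1 i)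
          (fun s hs e => hjS (e ▸ (hc s hs).1))
          (by
            intro t ht
            constructor
            · intro h3
              by_contra hne
              push Not at hne
              exact h3 (hmid t (by omega) (by omega))
            · rintro (rfl | rfl)
              · rw [hv0]; exact ha
              · rw [hvn]; exact hb)
          (fun i => hsupp i j)
        rw [hv0, hvn] at this
        simp only [ρ]
        rw [div_eq_div_iff ha hb]
        exact this
    -- component scaling
    let σ : G.ConnectedComponent → ℝ := fun C =>
      if hC : ∃ i, G.connectedComponentMk i = C ∧ M' i j ≠ 0 then ρ hC.choose else 1
    have hσne : ∀ C, σ C ≠ 0 := by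
      intro C
      simp only [σ]
      split_ifs with hC
      · have := hC.choose_spec.2
        exact div_ne_zero (div_ne_zero (fun e => this ((hsupp _ _).1 e)) (hr _)) this
      · exact one_ne_zero
    have hσ : ∀ i, M' i j ≠ 0 → σ (G.connectedComponentMk i) = ρ i := by
      intro i hi
      have hC : ∃ i', G.connectedComponentMk i' = G.connectedComponentMk i ∧ M' i' j ≠ 0 :=
        ⟨i, rfl, hi⟩
      simp only [σ]
      rw [dif_pos hC]
      exact key _ _ _ (SimpleGraph.ConnectedComponent.exact hC.choose_spec.1) rfl
        hC.choose_spec.2 hi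
    let τ : Fin N → ℝ := fun c =>
      if hC : ∃ i, M' i c ≠ 0 then σ (G.connectedComponentMk hC.choose) else 1
    have hτne : ∀ c, τ c ≠ 0 := by
      intro c
      simp only [τ]
      split_ifs
      · exact hσne _
      · exact one_ne_zero
    have hτ : ∀ c ∈ S, ∀ i, M' i c ≠ 0 → τ c = σ (G.connectedComponentMk i) := by
      intro c hc i hi
      have hC : ∃ i, M' i c ≠ 0 := ⟨i, hi⟩
      simp only [τ]
      rw [dif_pos hC]
      congr 1
      by_cases e : hC.choose = i
      · rw [e]
      · apply SimpleGraph.ConnectedComponent.sound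
        exact SimpleGraph.Adj.reachable ⟨e, c, hc, hC.choose_spec, hi⟩
    refine ⟨fun i => r i * σ (G.connectedComponentMk i),
      fun c => if c = j then 1 else q c / τ c, fun i => mul_ne_zero (hr i) (hσne _), ?_, ?_⟩
    · intro c
      dsimp only
      split_ifs
      · exact one_ne_zero
      · exact div_ne_zero (hq c) (hτne c)
    · intro c hc i
      by_cases hi : M' i c = 0
      · rw [hi, (hsupp i c).2 hi]; ring
      · rcases Finset.mem_insert.1 hc with rfl | hcS
        · have := hr i
          simp only [if_true, hσ i hi, ρ]
          field_simp
        · have hne : c ≠ j := fun e => hjS (e ▸ hcS)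
          have := hσne (G.connectedComponentMk i)
          simp only [if_neg hne, hτ c hcS i hi, h c hcS i]
          field_simp

/-- small minors of a matrix in standard form are maximal minors -/
lemma minor_extend {d N k : ℕ} (M : Matrix (Fin d) (Fin N) ℝ) (b : Fin d → Fin N)
    (hb : M.submatrix id b = 1) (f : Fin k → Fin d) (g : Fin k → Fin N)
    (hf : Function.Injective f) :
    ∃ h : Fin d → Fin N, ∀ M₂ : Matrix (Fin d) (Fin N) ℝ, M₂.submatrix id b = 1 →
      (M₂.submatrix f g).det = (M₂.submatrix id h).det := by
  classical
  let h : Fin d → Fin N := fun i => if hi : ∃ s, f s = i then g hi.choose else b i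
  have hhf : ∀ s, h (f s) = g s := by
    intro s
    have hi : ∃ s', f s' = f s := ⟨s, rfl⟩
    simp only [h]
    rw [dif_pos hi, hf hi.choose_spec]
  have hhn : ∀ i, (¬ ∃ s, f s = i) → h i = b i := fun i hi => by simp only [h]; rw [dif_neg hi]
  refine ⟨h, fun M₂ hM₂ => ?_⟩
  have hone : ∀ i i', M₂ i (b i') = (1 : Matrix (Fin d) (Fin d) ℝ) i i' := by
    intro i i'; rw [← hM₂]; rfl
  rw [Matrix.twoBlockTriangular_det' (M₂.submatrix id h) (fun i => ∃ s, f s = i)]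
  · have e2 : (Matrix.toSquareBlockProp (M₂.submatrix id h) (fun i => ¬ ∃ s, f s = i)) = 1 := by
      ext ⟨i, hi⟩ ⟨i', hi'⟩
      simp only [Matrix.toSquareBlockProp_def, Matrix.of_apply, Matrix.submatrix_apply, id]
      rw [hhn i' hi', hone]
      simp [Matrix.one_apply, Subtype.ext_iff]
    rw [e2, Matrix.det_one, mul_one]
    let e : Fin k ≃ {i // ∃ s, f s = i} := Equiv.ofInjective f hf
    rw [← Matrix.det_submatrix_equiv_self e]
    congr 1
    ext s t
    simp only [Matrix.toSquareBlockProp_def, Matrix.of_apply, Matrix.submatrix_apply, id]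
    change _ = M₂ (f s) (h (f t))
    rw [hhf]
  · intro i hi i' hi'
    simp only [Matrix.submatrix_apply, id]
    rw [hhn i' hi', hone, Matrix.one_apply_ne]
    rintro rfl
    exact hi' hi

/-- vanishing of arbitrary column selections -/
lemma zero_iff_all {d N : ℕ} (X A : Matrix (Fin d) (Fin N) ℝ)
    (hXA : ∀ I : Finset (Fin N), I.card = d → (maxMinor X I = 0 ↔ maxMinor A I = 0))
    (h : Fin d → Fin N) : (X.submatrix id h).det = 0 ↔ (A.submatrix id h).det = 0 := by
  classical
  by_cases hh : Function.Injective h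
  · let I := Finset.univ.image h
    have hI : I.card = d := by
      rw [Finset.card_image_of_injective _ hh]; simp
    have := hXA I hI
    simp only [maxMinor, dif_pos hI] at this
    have hmem : ∀ i, h i ∈ I := fun i => Finset.mem_image_of_mem _ (Finset.mem_univ i)
    let π : Fin d → Fin d := fun i => (I.orderIsoOfFin hI).symm ⟨h i, hmem i⟩
    have hπ : Function.Injective π := by
      intro s t e
      have := (I.orderIsoOfFin hI).symm.injective e
      exact hh (Subtype.ext_iff.1 this)
    let e : Equiv.Perm (Fin d) := Equiv.ofBijective π (Finite.injective_iff_bijective.1 hπ)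
    have he : h = (fun j => ((I.orderIsoOfFin hI) j).val) ∘ e := by
      funext i
      simp only [e, π, Function.comp_apply, Equiv.ofBijective_apply, OrderIso.apply_symm_apply]
    have hdet : ∀ Y : Matrix (Fin d) (Fin N) ℝ, (Y.submatrix id h).det = 0 ↔
        (Y.submatrix id (fun j => ((I.orderIsoOfFin hI) j).val)).det = 0 := by
      intro Y
      have : Y.submatrix id h =
        (Y.submatrix id (fun j => ((I.orderIsoOfFin hI) j).val)).submatrix id e := by
        rw [Matrix.submatrix_submatrix, ← he]; rfl
      rw [this, Matrix.det_permute']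
      rcases Int.units_eq_one_or (Equiv.Perm.sign e) with h1 | h1 <;> simp [h1]
    rw [hdet, hdet]
    exact this
  · rw [Function.Injective] at hh
    push Not at hh
    obtain ⟨s, t, e, hne⟩ := hh
    have : ∀ Y : Matrix (Fin d) (Fin N) ℝ, (Y.submatrix id h).det = 0 := fun Y =>
      Matrix.det_zero_of_column_eq hne (fun i => by simp [e])
    simp [this]

lemma unimod_all {d N : ℕ} (A : Matrix (Fin d) (Fin N) ℝ) (hA : IsTotUnimod A)
    (h : Fin d → Fin N) : (A.submatrix id h).det = 0 ∨ (A.submatrix id h).det = 1 ∨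
      (A.submatrix id h).det = -1 := by
  by_cases hh : Function.Injective h
  · exact hA d id h Function.injective_id hh
  · rw [Function.Injective] at hh
    push Not at hh
    obtain ⟨s, t, e, hne⟩ := hh
    exact Or.inl (Matrix.det_zero_of_column_eq hne (fun i => by simp [e]))

lemma det_scaling {d N : ℕ} (X A : Matrix (Fin d) (Fin N) ℝ) (hA : IsTotUnimod A)
    (hXA : ∀ I : Finset (Fin N), I.card = d → (maxMinor X I = 0 ↔ maxMinor A I = 0))
    (b : Fin d → Fin N) (hb : (X.submatrix id b).det ≠ 0) :
    ∃ (γ : ℝ) (q : Fin N → ℝ), γ ≠ 0 ∧ (∀ j, q j ≠ 0) ∧ ∀ h : Fin d → Fin N,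
      (X.submatrix id h).det = γ * (A.submatrix id h).det * ∏ i, q (h i) := by
  classical
  have hall := zero_iff_all X A hXA
  have hbA : (A.submatrix id b).det ≠ 0 := fun e => hb ((hall b).2 e)
  have hsub : ∀ (P : Matrix (Fin d) (Fin d) ℝ) (Y : Matrix (Fin d) (Fin N) ℝ)
      (h : Fin d → Fin N), (P * Y).submatrix id h = P * Y.submatrix id h := by
    intro P Y h; ext i j; simp [Matrix.mul_apply]
  let M := (X.submatrix id b)⁻¹ * X
  let M' := (A.submatrix id b)⁻¹ * A
  have hM : M.submatrix id b = 1 := by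
    rw [hsub, Matrix.nonsing_inv_mul _ (isUnit_iff_ne_zero.2 hb)]
  have hM' : M'.submatrix id b = 1 := by
    rw [hsub, Matrix.nonsing_inv_mul _ (isUnit_iff_ne_zero.2 hbA)]
  have hdM : ∀ h, (M.submatrix id h).det = (X.submatrix id b).det⁻¹ * (X.submatrix id h).det := by
    intro h
    rw [hsub, Matrix.det_mul, Matrix.det_nonsing_inv, Ring.inverse_eq_inv']
  have hdM' : ∀ h, (M'.submatrix id h).det =
      (A.submatrix id b).det⁻¹ * (A.submatrix id h).det := by
    intro h
    rw [hsub, Matrix.det_mul, Matrix.det_nonsing_inv, Ring.inverse_eq_inv']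
  have hTU : IsTotUnimod M' := by
    intro k f g hf _
    obtain ⟨h, hh⟩ := minor_extend M' b hM' f g hf
    rw [hh M' hM', hdM']
    rcases unimod_all A hA b with e | e | e
    · exact absurd e hbA
    · rw [e]; simpa using unimod_all A hA h
    · rw [e]
      rcases unimod_all A hA h with e' | e' | e' <;> rw [e'] <;> norm_num
  have hz : ∀ (k : ℕ) (f : Fin k → Fin d) (g : Fin k → Fin N), Function.Injective f →
      Function.Injective g → ((M.submatrix f g).det = 0 ↔ (M'.submatrix f g).det = 0) := by
    intro k f g hf _
    obtain ⟨h, hh⟩ := minor_extend M' b hM' f g hf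
    rw [hh M' hM', hh M hM, hdM', hdM]
    simp only [mul_eq_zero, inv_eq_zero, hb, hbA, false_or]
    exact hall h
  obtain ⟨r, q, hr, hq, hrq⟩ := exists_scaling M M' hTU hz Finset.univ
  refine ⟨(X.submatrix id b).det * (∏ i, r i) * (A.submatrix id b).det⁻¹, q, ?_, hq, ?_⟩
  · exact mul_ne_zero (mul_ne_zero hb (Finset.prod_ne_zero_iff.2 fun i _ => hr i))
      (inv_ne_zero hbA)
  · intro h
    have e : (M.submatrix id h).det = (∏ i, r i) * (M'.submatrix id h).det * ∏ i, q (h i) := by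
      rw [← Matrix.det_mul_column, mul_comm, ← Matrix.det_mul_row]
      congr 1
      ext i j
      simp only [Matrix.submatrix_apply, id, Matrix.of_apply]
      rw [hrq (h j) (Finset.mem_univ _) i]; ring
    rw [hdM, hdM', inv_mul_eq_iff_eq_mul₀ hb] at e
    rw [e]; ring

theorem regular_plucker_power_real_signed (d N : ℕ) (hd : 0 < d) (hdN : d ≤ N)
    (X : Matrix (Fin d) (Fin N) ℝ) (hX : X.rank = d) (hreg : RepresentsRegular X)
    (k : ℝ) :
    ∃ Xk : Matrix (Fin d) (Fin N) ℝ, ∀ I : Finset (Fin N), I.card = d →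
      (maxMinor X I = 0 → maxMinor Xk I = 0) ∧
      (maxMinor X I ≠ 0 →
        |maxMinor Xk I| = |maxMinor X I| ^ k ∧ maxMinor Xk I * maxMinor X I ≥ 0) := by
  classical
  obtain ⟨A, hA, hXA⟩ := hreg
  by_cases hB : ∃ B : Finset (Fin N), ∃ h : B.card = d, maxMinor X B ≠ 0
  swap
  · refine ⟨0, fun I hI => ⟨fun _ => ?_, fun hne => absurd ⟨I, hI, hne⟩ hB⟩⟩
    haveI : Nonempty (Fin d) := ⟨⟨0, hd⟩⟩
    simp [maxMinor, hI]
  obtain ⟨B, hBc, hB⟩ := hB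
  simp only [maxMinor, dif_pos hBc] at hB
  obtain ⟨γ, q, hγ, hq, hdet⟩ := det_scaling X A hA hXA _ hB
  let φ : ℝ → ℝ := fun t => SignType.sign t * |t| ^ k
  have hφabs : ∀ t, t ≠ 0 → |φ t| = |t| ^ k := by
    intro t ht
    have h1 : 0 < |t| ^ k := Real.rpow_pos_of_pos (abs_pos.2 ht) k
    rcases lt_or_gt_of_ne ht with h | h
    · simp [φ, h, abs_of_pos h1]
    · simp only [φ, sign_pos h, SignType.coe_one, one_mul, abs_of_pos h1]
  have hφs : ∀ t, 0 ≤ φ t * t := by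
    intro t
    have h1 : 0 ≤ |t| ^ k := Real.rpow_nonneg (abs_nonneg t) k
    have : φ t * t = |t| ^ k * |t| := by
      have e := sign_mul_self t; simp only [φ]; linear_combination |t| ^ k * e
    rw [this]; positivity
  let Xk : Matrix (Fin d) (Fin N) ℝ :=
    Matrix.of fun i j => (if i = ⟨0, hd⟩ then φ γ else 1) * A i j * φ (q j)
  have hdetk : ∀ h : Fin d → Fin N,
      (Xk.submatrix id h).det = φ γ * (A.submatrix id h).det * ∏ i, φ (q (h i)) := by
    intro h
    have : φ γ = ∏ i : Fin d, (if i = ⟨0, hd⟩ then φ γ else 1) := by simp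
    rw [this, ← Matrix.det_mul_column, mul_comm, ← Matrix.det_mul_row]
    congr 1
    ext i j
    simp only [Xk, Matrix.submatrix_apply, id, Matrix.of_apply]
    ring
  refine ⟨Xk, fun I hI => ?_⟩
  have hI' := hXA I hI
  simp only [maxMinor, dif_pos hI] at hI' ⊢
  set h : Fin d → Fin N := fun j => ((I.orderIsoOfFin hI) j).val
  rw [hdetk h]
  refine ⟨fun e => ?_, fun e => ?_⟩
  · rw [hI'.1 e]; ring
  · have hne : (A.submatrix id h).det ≠ 0 := fun e' => e (hI'.2 e')
    rw [hdet h]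
    have habs : |(A.submatrix id h).det| = 1 := by
      rcases unimod_all A hA h with e' | e' | e'
      · exact absurd e' hne
      · simp [e']
      · simp [e']
    constructor
    · simp only [abs_mul, habs, mul_one, Finset.abs_prod]
      rw [Real.mul_rpow (abs_nonneg _) (Finset.prod_nonneg fun _ _ => abs_nonneg _),
        ← Real.finsetProd_rpow _ _ (fun _ _ => abs_nonneg _), hφabs γ hγ]
      congr 1
      exact Finset.prod_congr rfl fun i _ => hφabs _ (hq _)
    · have : φ γ * (A.submatrix id h).det * (∏ i, φ (q (h i))) *
          (γ * (A.submatrix id h).det * ∏ i, q (h i)) =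
          (φ γ * γ) * ((A.submatrix id h).det)^2 * ∏ i, (φ (q (h i)) * q (h i)) := by
        rw [Finset.prod_mul_distrib (f := fun i => φ (q (h i))) (g := fun i => q (h i))]; ring
      rw [this]
      exact mul_nonneg (mul_nonneg (hφs γ) (sq_nonneg _)) (Finset.prod_nonneg fun i _ => hφs _)
end

section
/- Let X be a 2×4 real matrix that represents the uniform matroid U_{2,4}, i.e. all six of its 2×2 maximal minors are nonzero, and let k be a non-negative real number with k ≠ 1. Then there is no 2×4 real matrix X_k such that |Δ_I(X_k)| = |Δ_I(X)|^k (real power) holds for all six 2-element subsets I of the column indices. -/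
theorem maxMinor_pair (X : Matrix (Fin 2) (Fin 4) ℝ) (i j : Fin 4) (hij : i < j) :
    maxMinor X {i, j} = X 0 i * X 1 j - X 0 j * X 1 i := by
  have hc : ({i, j} : Finset (Fin 4)).card = 2 := Finset.card_pair hij.ne
  have key : (![i, j] : Fin 2 → Fin 4) = ({i, j} : Finset (Fin 4)).orderEmbOfFin hc := by
    apply Finset.orderEmbOfFin_unique
    · intro x
      fin_cases x <;> simp
    · intro x y hxy
      fin_cases x <;> fin_cases y <;> simp_all
  have h2 : (fun t : Fin 2 => ((({i, j} : Finset (Fin 4)).orderIsoOfFin hc) t).val) = ![i, j] := by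
    rw [key]; ext t; simp
  unfold maxMinor
  rw [dif_pos hc, h2, Matrix.det_fin_two]
  simp

theorem core_sum {a b c k : ℝ} (hb : 0 < b) (hc : 0 < c) (hk0 : 0 ≤ k) (hk1 : k ≠ 1)
    (h : a = b + c)
    (h' : a ^ k = b ^ k + c ^ k ∨ b ^ k = a ^ k + c ^ k ∨ c ^ k = a ^ k + b ^ k) : False := by
  have ha : 0 < a := by linarith
  have hba : b < a := by linarith
  have hca : c < a := by linarith
  have pb := Real.rpow_pos_of_pos hb k
  have pc := Real.rpow_pos_of_pos hc k
  have mb := Real.rpow_le_rpow hb.le hba.le hk0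
  have mc := Real.rpow_le_rpow hc.le hca.le hk0
  rcases h' with h' | h' | h'
  · have e : ∀ x : ℝ, 0 < x → x ^ k = x * x ^ (k - 1) := fun x hx => by
      rw [Real.rpow_sub_one hx.ne']; field_simp
    rw [e a ha, e b hb, e c hc] at h'
    have h2 : b * a ^ (k-1) + c * a ^ (k-1) = b * b ^ (k-1) + c * c ^ (k-1) := by
      rw [← h', ← add_mul, ← h]
    rcases lt_or_gt_of_ne hk1 with hk | hk
    · have h3 := mul_lt_mul_of_pos_left (Real.rpow_lt_rpow_of_neg hb hba (sub_neg.2 hk)) hb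
      have h4 := mul_lt_mul_of_pos_left (Real.rpow_lt_rpow_of_neg hc hca (sub_neg.2 hk)) hc
      linarith
    · have h3 := mul_lt_mul_of_pos_left (Real.rpow_lt_rpow hb.le hba (sub_pos.2 hk)) hb
      have h4 := mul_lt_mul_of_pos_left (Real.rpow_lt_rpow hc.le hca (sub_pos.2 hk)) hc
      linarith
  · linarith
  · linarith

theorem abs_three {p q r : ℝ} (h : p - q + r = 0) :
    |p| = |q| + |r| ∨ |q| = |p| + |r| ∨ |r| = |p| + |q| := by
  rcases abs_choice p with hp | hp <;> rcases abs_choice q with hq | hq <;>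
    rcases abs_choice r with hr | hr <;>
    have := abs_nonneg p <;> have := abs_nonneg q <;> have := abs_nonneg r <;> grind

theorem plucker (X : Matrix (Fin 2) (Fin 4) ℝ) :
    maxMinor X {0, 1} * maxMinor X {2, 3} - maxMinor X {0, 2} * maxMinor X {1, 3}
      + maxMinor X {0, 3} * maxMinor X {1, 2} = 0 := by
  rw [maxMinor_pair X 0 1 (by decide), maxMinor_pair X 2 3 (by decide),
    maxMinor_pair X 0 2 (by decide), maxMinor_pair X 1 3 (by decide),
    maxMinor_pair X 0 3 (by decide), maxMinor_pair X 1 2 (by decide)]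
  ring

/-- **Lemma 5.1 (ii), real case.** If a real `2 × 4` matrix `X` represents `U_{2,4}` (all six
maximal minors are nonzero) and `k` is a non-negative real with `k ≠ 1`, then no real
`2 × 4` matrix `X_k` satisfies `|Δ_I(X_k)| = |Δ_I(X)|^k` for all six `I`. -/
theorem no_kth_power_U24_real (X : Matrix (Fin 2) (Fin 4) ℝ)
    (hU : ∀ I : Finset (Fin 4), I.card = 2 → maxMinor X I ≠ 0)
    (k : ℝ) (hk0 : 0 ≤ k) (hk1 : k ≠ 1) :
    ¬ ∃ Xk : Matrix (Fin 2) (Fin 4) ℝ, ∀ I : Finset (Fin 4), I.card = 2 →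
        |maxMinor Xk I| = |maxMinor X I| ^ k := by
  rintro ⟨Y, hY⟩
  have A := abs_three (plucker X)
  have B := abs_three (plucker Y)
  have e : ∀ I J : Finset (Fin 4), I.card = 2 → J.card = 2 →
      |maxMinor Y I * maxMinor Y J| = |maxMinor X I * maxMinor X J| ^ k := fun I J hI hJ => by
    rw [abs_mul, abs_mul, hY I hI, hY J hJ, Real.mul_rpow (abs_nonneg _) (abs_nonneg _)]
  have p : ∀ I J : Finset (Fin 4), I.card = 2 → J.card = 2 →
      0 < |maxMinor X I * maxMinor X J| := fun I J hI hJ =>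
    abs_pos.2 (mul_ne_zero (hU I hI) (hU J hJ))
  rw [e {0, 1} {2, 3} (by decide) (by decide), e {0, 2} {1, 3} (by decide) (by decide),
    e {0, 3} {1, 2} (by decide) (by decide)] at B
  have p1 := p {0, 1} {2, 3} (by decide) (by decide)
  have p2 := p {0, 2} {1, 3} (by decide) (by decide)
  have p3 := p {0, 3} {1, 2} (by decide) (by decide)
  rcases A with A | A | A
  · exact core_sum p2 p3 hk0 hk1 A B
  · exact core_sum p1 p3 hk0 hk1 A (by grind)
  · exact core_sum p1 p2 hk0 hk1 A (by grind)
end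

section
/- Let d ≤ N be positive integers and let P ⊆ ℂ^{B}, where B is the set of all d-element subsets of {1,…,N}, be the set of all Plücker vectors: P = { (Δ_I(X))_{I ∈ B} : X a d×N complex matrix }. Let k ≥ 1 be an integer and let σ : B → {1,−1} be a choice of signs. Then the image of P under the map ξ ↦ (σ_I · ξ_I^k)_{I ∈ B} is Zariski-closed: there exists a set S of polynomials in the variables indexed by B with complex coefficients such that this image equals the set of common zeros of S. -/
theorem lying_over_hom {R S : Type*} [CommRing R] [CommRing S] (f : R →+* S) (hf : f.IsIntegral)
    (P : Ideal R) [P.IsPrime] (I : Ideal S) (h : I.comap f ≤ P) :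
    ∃ Q ≥ I, Q.IsPrime ∧ Q.comap f = P := by
  let : Algebra R S := f.toAlgebra
  have : Algebra.IsIntegral R S := ⟨hf⟩
  exact Ideal.exists_ideal_over_prime_of_isIntegral P I h

open MvPolynomial in
theorem finite_image_closed {B : Type} [Finite B] (k : ℕ) (hk : 1 ≤ k) (σ : B → ℂ)
    (hσ : ∀ I, σ I = 1 ∨ σ I = -1) (T : Set (MvPolynomial B ℂ)) :
    ∃ S : Set (MvPolynomial B ℂ),
      ((fun ξ : B → ℂ => fun I => σ I * ξ I ^ k) '' {v | ∀ p ∈ T, eval v p = 0}) =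
      {v | ∀ p ∈ S, eval v p = 0} := by
  let φ : MvPolynomial B ℂ →ₐ[ℂ] MvPolynomial B ℂ := aeval (fun I => C (σ I) * X I ^ k)
  have hφ : ∀ (ξ : B → ℂ) p, eval ξ (φ p) = eval (fun I => σ I * ξ I ^ k) p := by
    intro ξ p
    have : ((aeval ξ : MvPolynomial B ℂ →ₐ[ℂ] ℂ).comp φ) = aeval (fun I => σ I * ξ I ^ k) := by
      ext I
      simp [φ]
    have h2 := DFunLike.congr_fun this p
    simpa [aeval_eq_eval] using h2
  have hσ2 : ∀ I, σ I * σ I = 1 := by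
    intro I; rcases hσ I with h | h <;> simp [h]
  let J := Ideal.span T
  refine ⟨(Ideal.comap φ.toRingHom J : Set _), ?_⟩
  have hJ : ∀ v : B → ℂ, (∀ p ∈ T, eval v p = 0) ↔ ∀ p ∈ J, eval v p = 0 := by
    intro v
    constructor
    · intro h p hp
      have : J ≤ RingHom.ker (eval v) := Ideal.span_le.2 (fun p hp => h p hp)
      exact this hp
    · intro h p hp
      exact h p (Ideal.subset_span hp)
  ext v
  constructor
  · rintro ⟨ξ, hξ, rfl⟩ p hp
    rw [← hφ]
    exact (hJ ξ).1 hξ _ hp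
  · intro hv
    have hint : φ.toRingHom.IsIntegral := by
      intro p
      induction p using MvPolynomial.induction_on with
      | C a =>
        have h : φ.toRingHom (C a) = C a := by simp [φ]
        rw [← h]
        exact RingHom.isIntegralElem_map _
      | add p q hp hq => exact RingHom.IsIntegralElem.add _ hp hq
      | mul_X p I hp =>
        refine RingHom.IsIntegralElem.mul _ hp ?_
        refine ⟨Polynomial.X ^ k - Polynomial.C (C (σ I) * X I),
          Polynomial.monic_X_pow_sub_C _ (by omega), ?_⟩
        have h : φ.toRingHom (C (σ I) * X I) = X I ^ k := by
          simp only [φ, AlgHom.toRingHom_eq_coe, RingHom.coe_coe, map_mul, aeval_X, algHom_C,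
            algebraMap_eq]
          rw [← mul_assoc, ← C_mul, hσ2, C_1, one_mul]
        simp only [Polynomial.eval₂_sub, Polynomial.eval₂_X_pow, Polynomial.eval₂_C, h, sub_self]
    have hle : J.comap φ.toRingHom ≤ vanishingIdeal ℂ {v} := by
      intro p hp
      rw [mem_vanishingIdeal_singleton_iff, aeval_eq_eval]
      exact hv p hp
    obtain ⟨Q, hQJ, hQ, hQv⟩ := lying_over_hom _ hint _ J hle
    have hQm : Q.IsMaximal := by
      refine Ideal.isMaximal_of_isIntegral_of_isMaximal_comap' _ hint Q ?_
      rw [hQv]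
      exact isMaximal_iff_eq_vanishingIdeal_singleton.2 ⟨v, rfl⟩
    obtain ⟨ξ, rfl⟩ := isMaximal_iff_eq_vanishingIdeal_singleton.1 hQm
    refine ⟨ξ, (hJ ξ).2 fun p hp => ?_, ?_⟩
    · have := hQJ hp
      rwa [mem_vanishingIdeal_singleton_iff, aeval_eq_eval] at this
    · funext I
      have h1 : (X I - C (v I) : MvPolynomial B ℂ) ∈ vanishingIdeal ℂ {v} := by
        rw [mem_vanishingIdeal_singleton_iff]; simp
      rw [← hQv, Ideal.mem_comap, mem_vanishingIdeal_singleton_iff, aeval_eq_eval] at h1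
      have h2 := (hφ ξ _).symm.trans h1
      simpa [sub_eq_zero] using h2

theorem exists_L {d N : ℕ} (f : Fin d → Fin N) :
    ∃ L : MvPolynomial {I : Finset (Fin N) // I.card = d} ℂ,
      ∀ X : Matrix (Fin d) (Fin N) ℂ,
        MvPolynomial.eval (fun I => maxMinor X I.1) L = (X.submatrix id f).det := by
  by_cases hf : Function.Injective f
  · let I : Finset (Fin N) := Finset.univ.image f
    have hI : I.card = d := by
      simp [I, Finset.card_image_of_injective _ hf]
    have hm : ∀ i, f i ∈ I := fun i => by simp [I]
    let g : Fin d → Fin d := fun i => (I.orderIsoOfFin hI).symm ⟨f i, hm i⟩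
    have hg : Function.Injective g := by
      intro a b h
      have := (I.orderIsoOfFin hI).symm.injective h
      exact hf (by simpa using this)
    let e : Equiv.Perm (Fin d) := Equiv.ofBijective g (Finite.injective_iff_bijective.1 hg)
    refine ⟨MvPolynomial.C ((Equiv.Perm.sign e : ℤ) : ℂ) * MvPolynomial.X ⟨I, hI⟩, fun X => ?_⟩
    have h1 := Matrix.det_permute' e
      (X.submatrix id (fun j : Fin d => ((I.orderIsoOfFin hI) j).val))
    have h2 : (X.submatrix id (fun j : Fin d => ((I.orderIsoOfFin hI) j).val)).submatrix id e
        = X.submatrix id f := by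
      ext i j
      simp only [Matrix.submatrix_apply, id]
      congr 1
      show ((I.orderIsoOfFin hI) ((I.orderIsoOfFin hI).symm ⟨f j, hm j⟩)).val = f j
      rw [OrderIso.apply_symm_apply]
    rw [← h2, h1]
    simp [maxMinor, hI]
  · refine ⟨0, fun X => ?_⟩
    rw [Function.not_injective_iff] at hf
    obtain ⟨a, b, hab, hne⟩ := hf
    rw [Matrix.det_zero_of_column_eq hne]
    · simp
    · intro i; simp [hab]

theorem plucker_closed (d N : ℕ) (hd : 0 < d) :
    ∃ T : Set (MvPolynomial {I : Finset (Fin N) // I.card = d} ℂ),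
      {v : {I : Finset (Fin N) // I.card = d} → ℂ |
        ∃ X : Matrix (Fin d) (Fin N) ℂ, ∀ I : {I : Finset (Fin N) // I.card = d},
          v I = maxMinor X I.1} = {v | ∀ p ∈ T, MvPolynomial.eval v p = 0} := by
  choose L hL using @exists_L d N
  let o : {I : Finset (Fin N) // I.card = d} → Fin d → Fin N :=
    fun I j => ((I.1.orderIsoOfFin I.2) j).val
  have ho : ∀ (X : Matrix (Fin d) (Fin N) ℂ) I, maxMinor X I.1 = (X.submatrix id (o I)).det := by
    intro X I
    simp [maxMinor, I.2, o]
  let M : {I : Finset (Fin N) // I.card = d} →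
      Matrix (Fin d) (Fin N) (MvPolynomial {I : Finset (Fin N) // I.card = d} ℂ) :=
    fun J => Matrix.of fun i c => L (Function.update (o J) i c)
  let R : {I : Finset (Fin N) // I.card = d} → {I : Finset (Fin N) // I.card = d} →
      MvPolynomial {I : Finset (Fin N) // I.card = d} ℂ := fun J I =>
    ((M J).submatrix id (o I)).det - MvPolynomial.X J ^ (d - 1) * MvPolynomial.X I
  have hR : ∀ v J I, MvPolynomial.eval v (R J I) =
      (((M J).map (MvPolynomial.eval v)).submatrix id (o I)).det - v J ^ (d - 1) * v I := by
    intro v J I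
    simp only [R, map_sub, map_mul, map_pow, MvPolynomial.eval_X, RingHom.map_det]
    rfl
  refine ⟨{p | ∃ J I, p = R J I}, ?_⟩
  ext v
  constructor
  · rintro ⟨X, hX⟩ p ⟨J, I, rfl⟩
    obtain rfl : v = fun I => maxMinor X I.1 := funext hX
    rw [hR]
    have : ((M J).map (MvPolynomial.eval fun I => maxMinor X I.1)).submatrix id (o I)
        = (X.submatrix id (o J)).adjugate * X.submatrix id (o I) := by
      ext i j
      simp only [M, Matrix.submatrix_apply, Matrix.map_apply, Matrix.of_apply, hL, id]
      have h := congrFun (Matrix.cramer_eq_adjugate_mulVec (X.submatrix id (o J))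
        (fun a => X a (o I j))) i
      rw [Matrix.cramer_apply] at h
      refine Eq.trans ?_ (h.trans rfl)
      congr 1
      ext a b
      by_cases hb : b = i
      · subst hb; simp
      · simp [hb]
    rw [this, Matrix.det_mul, Matrix.det_adjugate, ← ho, ← ho]
    simp
  · intro hv
    by_cases h0 : v = 0
    · refine ⟨0, fun I => ?_⟩
      rw [ho, h0]
      have : Nonempty (Fin d) := ⟨⟨0, hd⟩⟩
      simp
    · obtain ⟨J, hJ⟩ := Function.ne_iff.1 h0
      simp only [Pi.zero_apply] at hJ
      obtain ⟨t, ht⟩ := IsAlgClosed.exists_pow_nat_eq ((v J ^ (d - 1))⁻¹) hd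
      refine ⟨t • (M J).map (MvPolynomial.eval v), fun I => ?_⟩
      have h := hv _ ⟨J, I, rfl⟩
      rw [hR, sub_eq_zero] at h
      have h3 : (t • (M J).map (MvPolynomial.eval v)).submatrix id (o I)
          = t • ((M J).map (MvPolynomial.eval v)).submatrix id (o I) := rfl
      rw [ho, h3, Matrix.det_smul, h, Fintype.card_fin, ht]
      field_simp

/-- **Lemma 3.11.** Let `P ⊆ ℂ^B` (with `B` the set of `d`-element subsets of the column
indices) be the set of Plücker vectors of `d × N` complex matrices. For `k ≥ 1` and a sign
choice `σ : B → {1, -1}`, the image of `P` under `ξ ↦ (σ_I · ξ_I^k)_I` is Zariski-closed: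
it is the common zero locus of a set of polynomials over `ℂ` in variables indexed by `B`. -/
theorem signed_power_image_of_plucker_vectors_is_zariski_closed
    (d N : ℕ) (hd : 0 < d) (hdN : d ≤ N) (k : ℕ) (hk : 1 ≤ k)
    (σ : {I : Finset (Fin N) // I.card = d} → ℂ)
    (hσ : ∀ I, σ I = 1 ∨ σ I = -1) :
    ∃ S : Set (MvPolynomial {I : Finset (Fin N) // I.card = d} ℂ),
      ((fun ξ : {I : Finset (Fin N) // I.card = d} → ℂ => fun I => σ I * ξ I ^ k) ''
        {v | ∃ X : Matrix (Fin d) (Fin N) ℂ, ∀ I : {I : Finset (Fin N) // I.card = d},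
          v I = maxMinor X I.1}) =
      {v | ∀ p ∈ S, MvPolynomial.eval v p = 0} := by
  obtain ⟨T, hT⟩ := plucker_closed d N hd
  rw [hT]
  exact finite_image_closed k hk σ hσ T
end

section
/- Let A be a totally unimodular d×N integer matrix and let D = diag(δ₁,…,δ_N) be a diagonal N×N integer matrix. Let T be a subset of the column indices of size r such that the columns of the product A·D indexed by T are linearly independent over ℚ. Then the greatest common divisor of the absolute values |det((A·D)[I,T])|, taken over all subsets I of the row indices with |I| = r, equals ∏_{j∈T} |δ_j|. -/
/-- `minor r X I J` is the determinant of the square submatrix of `X` whose rows are the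
elements of `I` and whose columns are the elements of `J` (each taken in increasing order),
where `I.card = J.card = r`. Junk value `0` if the cardinalities do not match. -/
noncomputable def minor {K : Type*} [CommRing K] {d N : ℕ} (r : ℕ)
    (X : Matrix (Fin d) (Fin N) K) (I : Finset (Fin d)) (J : Finset (Fin N)) : K :=
  if h : I.card = r ∧ J.card = r then
    (X.submatrix (fun i : Fin r => ((I.orderIsoOfFin h.1) i).val)
                 (fun j : Fin r => ((J.orderIsoOfFin h.2) j).val)).det
  else 0

theorem aux_minor_mul {d N : ℕ} (A : Matrix (Fin d) (Fin N) ℤ) (δ : Fin N → ℤ)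
    (r : ℕ) (T : Finset (Fin N)) (I : Finset (Fin d)) (hT : T.card = r) :
    minor r (A * Matrix.diagonal δ) I T = minor r A I T * ∏ j ∈ T, δ j := by
  unfold minor
  split_ifs with h
  · have e : (A * Matrix.diagonal δ).submatrix
        (fun i : Fin r => ((I.orderIsoOfFin h.1) i).val)
        (fun j : Fin r => ((T.orderIsoOfFin h.2) j).val) =
        A.submatrix (fun i : Fin r => ((I.orderIsoOfFin h.1) i).val)
          (fun j : Fin r => ((T.orderIsoOfFin h.2) j).val) *
        Matrix.diagonal (fun j : Fin r => δ ((T.orderIsoOfFin h.2) j).val) := by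
      ext i j
      simp [Matrix.mul_diagonal]
    rw [e, Matrix.det_mul, Matrix.det_diagonal]
    congr 1
    rw [← Finset.prod_coe_sort T δ]
    exact Equiv.prod_comp (T.orderIsoOfFin h.2).toEquiv (fun j : T => δ j.val)
  · simp

theorem aux_exists_minor {d N : ℕ} (B : Matrix (Fin d) (Fin N) ℤ)
    (r : ℕ) (T : Finset (Fin N)) (hT : T.card = r)
    (hind : LinearIndependent ℚ (fun j : T => fun i : Fin d => (B i j.val : ℚ))) :
    ∃ I : Finset (Fin d), I.card = r ∧ minor r B I T ≠ 0 := by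
  classical
  let M : Matrix (Fin d) (Fin r) ℚ :=
    Matrix.of fun i k => (B i ((T.orderIsoOfFin hT) k).val : ℚ)
  have h1 : LinearIndependent ℚ M.transpose.row :=
    hind.comp (T.orderIsoOfFin hT) (T.orderIsoOfFin hT).injective
  have h2 : M.rank = r := by
    rw [← Matrix.rank_transpose, h1.rank_matrix, Fintype.card_fin]
  obtain ⟨κ, a, ha, hs, hl⟩ := exists_linearIndependent' ℚ M.row
  haveI : Finite κ := Finite.of_injective a ha
  haveI := Fintype.ofFinite κ
  have hc : Fintype.card κ = r := by
    rw [← finrank_span_eq_card hl, hs, ← Matrix.rank_eq_finrank_span_row, h2]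
  have hI : (Finset.univ.image a).card = r := by
    rw [Finset.card_image_of_injective _ ha, Finset.card_univ, hc]
  refine ⟨Finset.univ.image a, hI, ?_⟩
  have hmem : ∀ i : Fin r, ∃ k, a k = (((Finset.univ.image a).orderIsoOfFin hI) i).val := by
    intro i
    obtain ⟨k, -, hk⟩ := Finset.mem_image.1 (((Finset.univ.image a).orderIsoOfFin hI) i).2
    exact ⟨k, hk⟩
  choose b hb using hmem
  have hbi : Function.Injective b := by
    intro i j hij
    apply ((Finset.univ.image a).orderIsoOfFin hI).injective
    apply Subtype.ext
    rw [← hb, ← hb, hij]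
  have hl2 := hl.comp b hbi
  unfold minor
  rw [dif_pos ⟨hI, hT⟩]
  intro h0
  set S := B.submatrix (fun i : Fin r => (((Finset.univ.image a).orderIsoOfFin hI) i).val)
                 (fun j : Fin r => ((T.orderIsoOfFin hT) j).val) with hS
  have h3 : LinearIndependent ℚ (S.map (Int.castRingHom ℚ)).row := by
    have e : (S.map (Int.castRingHom ℚ)).row = (M.row ∘ a) ∘ b := by
      funext i j
      change ((B _ _ : ℤ) : ℚ) = ((B (a (b i)) _ : ℤ) : ℚ)
      rw [hb]
    rw [e]
    exact hl2
  rw [Matrix.linearIndependent_rows_iff_isUnit, Matrix.isUnit_iff_isUnit_det] at h3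
  apply h3.ne_zero
  have := (Int.castRingHom ℚ).map_det S
  rw [RingHom.mapMatrix_apply] at this
  rw [← this, h0, map_zero]

/-- **Lemma 7.5 (key computation).** Let `A` be a totally unimodular integer matrix,
`D = diag(δ)`, and `T` a set of `r` column indices such that the corresponding columns of
`A · D` are linearly independent over `ℚ`. Then the gcd of the absolute values of the
`r × r` minors of `A · D` using the columns `T`, over all `r`-element sets `I` of row
indices, equals `∏_{j ∈ T} |δ_j|`. -/
theorem gcd_of_minors_of_scaled_unimodular (d N : ℕ)
    (A : Matrix (Fin d) (Fin N) ℤ) (hA : IsTotUnimod A) (δ : Fin N → ℤ)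
    (r : ℕ) (T : Finset (Fin N)) (hT : T.card = r)
    (hind : LinearIndependent ℚ
      (fun j : T => fun i : Fin d => ((A * Matrix.diagonal δ) i j.val : ℚ))) :
    (Finset.univ.powersetCard r).gcd
        (fun I : Finset (Fin d) => |minor r (A * Matrix.diagonal δ) I T|) =
      ∏ j ∈ T, |δ j| := by
  have hm : ∀ I, |minor r (A * Matrix.diagonal δ) I T| = |minor r A I T| * ∏ j ∈ T, |δ j| := by
    intro I
    rw [aux_minor_mul A δ r T I hT, abs_mul, Finset.abs_prod]
  have hP : 0 ≤ ∏ j ∈ T, |δ j| := Finset.prod_nonneg fun _ _ => abs_nonneg _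
  obtain ⟨I, hI, h0⟩ := aux_exists_minor _ r T hT hind
  have h1 : |minor r A I T| = 1 := by
    have hne : minor r A I T ≠ 0 := by
      intro h
      apply h0
      rw [aux_minor_mul A δ r T I hT, h, zero_mul]
    unfold minor at hne ⊢
    rw [dif_pos ⟨hI, hT⟩] at hne ⊢
    rcases hA r _ _ (Subtype.val_injective.comp (I.orderIsoOfFin hI).injective)
      (Subtype.val_injective.comp (T.orderIsoOfFin hT).injective) with h | h | h
    · exact absurd h hne
    · exact (congrArg abs h).trans (by simp)
    · exact (congrArg abs h).trans (by simp)
  apply dvd_antisymm_of_normalize_eq Finset.normalize_gcd (Int.normalize_of_nonneg hP)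
  · have := Finset.gcd_dvd (f := fun I : Finset (Fin d) => |minor r (A * Matrix.diagonal δ) I T|)
      (Finset.mem_powersetCard.2 ⟨Finset.subset_univ I, hI⟩)
    rwa [hm, h1, one_mul] at this
  · apply Finset.dvd_gcd
    intro J _
    rw [hm]
    exact dvd_mul_left _ _
end

section
/- Let K be an algebraically closed field whose characteristic is not 2, and let k ≥ 3 be an integer not divisible by the characteristic of K (this holds automatically in characteristic 0). Then there exist 2×4 matrices X and X_k over K, both representing the uniform matroid U_{2,4} (i.e. all six 2×2 maximal minors of each are nonzero), such that for every 2-element subset I of the column indices, Δ_I(X_k) = Δ_I(X)^k or Δ_I(X_k) = −Δ_I(X)^k. -/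
lemma maxMinor_two (K : Type*) [CommRing K] (I : Finset (Fin 4)) (h : I.card = 2) :
    ∃ i j : Fin 4, i < j ∧ ∀ X : Matrix (Fin 2) (Fin 4) K,
      maxMinor X I = X 0 i * X 1 j - X 0 j * X 1 i := by
  refine ⟨(I.orderIsoOfFin h 0).val, (I.orderIsoOfFin h 1).val, ?_, fun X => ?_⟩
  · exact (I.orderIsoOfFin h).strictMono (by decide : (0 : Fin 2) < 1)
  · rw [maxMinor, dif_pos h, Matrix.det_fin_two]
    simp

open Polynomial in
lemma exists_good_root {K : Type*} [Field K] [IsAlgClosed K]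
    (hchar : ringChar K ≠ 2) (k : ℕ) (hk : 3 ≤ k) (hdvd : ¬ (ringChar K ∣ k)) :
    ∃ t : K, t ≠ 0 ∧ t - 1 ≠ 0 ∧ t ^ k + (-1) ^ k * (t - 1) ^ k + 1 = 0 := by
  have h2 : (2 : K) ≠ 0 := Ring.two_ne_zero hchar
  have hk0 : (k : K) ≠ 0 := fun h => hdvd ((ringChar.spec K k).1 h)
  have hkk : k ≠ 0 := by omega
  have hk1 : k - 1 ≠ 0 := by omega
  have hdeg : (X ^ k + C ((-1) ^ k) * (X - C 1) ^ k + C 1 : K[X]).degree ≠ 0 := by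
    intro hd
    obtain ⟨c, hc⟩ : ∃ c : K, (X ^ k + C ((-1) ^ k) * (X - C 1) ^ k + C 1 : K[X]) = C c :=
      ⟨_, eq_C_of_degree_eq_zero hd⟩
    have h1 := congrArg (fun p => eval 1 (derivative p)) hc
    simp [derivative_pow, hk1] at h1
    exact hk0 h1
  obtain ⟨t, ht⟩ := IsAlgClosed.exists_root _ hdeg
  simp only [IsRoot.def, eval_add, eval_mul, eval_pow, eval_X, eval_C, eval_sub] at ht
  refine ⟨t, ?_, ?_, ht⟩
  · rintro rfl
    apply h2
    rw [zero_pow hkk, zero_sub, ← mul_pow] at ht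
    norm_num at ht
    rw [← ht]
  · intro h
    have : t = 1 := sub_eq_zero.1 h
    subst this
    apply h2
    rw [h, zero_pow hkk, one_pow] at ht
    rw [← ht]; ring

/-- **Proposition 2.4 (algebraically closed case).** Over an algebraically closed field of
characteristic `≠ 2`, for any integer `k ≥ 3` not divisible by the characteristic, there
are `2 × 4` matrices `X` and `X_k`, both representing `U_{2,4}`, with
`Δ_I(X_k) = ± Δ_I(X)^k` for every `2`-element set `I` of column indices. -/
theorem counterexample_alg_closed {K : Type*} [Field K] [IsAlgClosed K]
    (hchar : ringChar K ≠ 2) (k : ℕ) (hk : 3 ≤ k) (hdvd : ¬ (ringChar K ∣ k)) :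
    ∃ X Xk : Matrix (Fin 2) (Fin 4) K,
      (∀ I : Finset (Fin 4), I.card = 2 → maxMinor X I ≠ 0) ∧
      (∀ I : Finset (Fin 4), I.card = 2 → maxMinor Xk I ≠ 0) ∧
      (∀ I : Finset (Fin 4), I.card = 2 →
        maxMinor Xk I = maxMinor X I ^ k ∨ maxMinor Xk I = -(maxMinor X I ^ k)) := by
  obtain ⟨t, h0, h1, ht⟩ := exists_good_root hchar k hk hdvd
  have hs : t ^ k + 1 = (t - 1) ^ k ∨ t ^ k + 1 = -((t - 1) ^ k) := by
    rcases neg_one_pow_eq_or K k with h | h <;> rw [h] at ht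
    · right; linear_combination ht
    · left; linear_combination ht
  have hA : ∀ I : Finset (Fin 4), I.card = 2 →
      maxMinor (!![1, 0, 1, 1; 0, 1, 1, t] : Matrix (Fin 2) (Fin 4) K) I ≠ 0 := by
    intro I hI
    obtain ⟨i, j, hij, h⟩ := maxMinor_two K I hI
    rw [h]
    fin_cases i <;> fin_cases j <;> simp_all
  have hB : ∀ I : Finset (Fin 4), I.card = 2 →
      maxMinor (!![1, 0, 1, -1; 0, 1, 1, t ^ k] : Matrix (Fin 2) (Fin 4) K) I
        = maxMinor (!![1, 0, 1, 1; 0, 1, 1, t] : Matrix (Fin 2) (Fin 4) K) I ^ k ∨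
      maxMinor (!![1, 0, 1, -1; 0, 1, 1, t ^ k] : Matrix (Fin 2) (Fin 4) K) I
        = -(maxMinor (!![1, 0, 1, 1; 0, 1, 1, t] : Matrix (Fin 2) (Fin 4) K) I ^ k) := by
    intro I hI
    obtain ⟨i, j, hij, h⟩ := maxMinor_two K I hI
    rw [h, h]
    rcases neg_one_pow_eq_or K k with h' | h' <;>
    fin_cases i <;> fin_cases j <;> first | (exact absurd hij (by decide)) | simp [h', hs]
  refine ⟨_, _, hA, ?_, hB⟩
  intro I hI h
  have := pow_ne_zero k (hA I hI)
  rcases hB I hI with h' | h' <;> rw [h] at h'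
  · exact this h'.symm
  · exact this (neg_eq_zero.1 h'.symm)
end

section
/- Let K be a field of characteristic p for a prime p ≥ 3. Then there exist 2×4 matrices X and X_p over K, both representing the uniform matroid U_{2,4} (i.e. all six 2×2 maximal minors of each are nonzero), such that for every 2-element subset I of the column indices, Δ_I(X_p) = Δ_I(X)^p or Δ_I(X_p) = −Δ_I(X)^p. -/
/-- **Proposition 2.4 (odd positive characteristic).** Over a field of characteristic
`p ≥ 3` there are `2 × 4` matrices `X` and `X_p`, both representing `U_{2,4}`, with
`Δ_I(X_p) = ± Δ_I(X)^p` for every `2`-element set `I` of column indices. -/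
theorem counterexample_char_p {K : Type*} [Field K]
    (p : ℕ) (hp : p.Prime) (hp3 : 3 ≤ p) [CharP K p] :
    ∃ X Xp : Matrix (Fin 2) (Fin 4) K,
      (∀ I : Finset (Fin 4), I.card = 2 → maxMinor X I ≠ 0) ∧
      (∀ I : Finset (Fin 4), I.card = 2 → maxMinor Xp I ≠ 0) ∧
      (∀ I : Finset (Fin 4), I.card = 2 →
        maxMinor Xp I = maxMinor X I ^ p ∨ maxMinor Xp I = -(maxMinor X I ^ p)) := by
  haveI : Fact p.Prime := ⟨hp⟩
  have h2 : (2 : K) ≠ 0 := by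
    intro h
    have h' : ((2 : ℕ) : K) = 0 := by exact_mod_cast h
    rw [CharP.cast_eq_zero_iff K p] at h'
    have := Nat.le_of_dvd (by norm_num) h'
    omega
  have h2' : (-1 - 1 : K) ≠ 0 := by
    intro h
    apply h2
    linear_combination -h
  have h2'' : (1 + 1 : K) ≠ 0 := by
    intro h
    apply h2
    linear_combination h
  let X : Matrix (Fin 2) (Fin 4) K := !![1, 0, 1, 1; 0, 1, 1, -1]
  have key : ∀ i j : Fin 4, i ≠ j → X 0 i * X 1 j - X 0 j * X 1 i ≠ 0 := by
    intro i j hij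
    fin_cases i <;> fin_cases j <;> first | exact absurd rfl hij | simp [X, h2', h2'']
  have hX : ∀ I : Finset (Fin 4), I.card = 2 → maxMinor X I ≠ 0 := by
    intro I hI
    rw [maxMinor, dif_pos hI, Matrix.det_fin_two]
    apply key
    intro h
    have := (I.orderIsoOfFin hI).injective (Subtype.ext h)
    exact absurd this (by decide)
  have hXp : ∀ I : Finset (Fin 4), I.card = 2 →
      maxMinor (X.map (frobenius K p)) I = maxMinor X I ^ p := by
    intro I hI
    rw [maxMinor, maxMinor, dif_pos hI, dif_pos hI, ← frobenius_def, RingHom.map_det]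
    rfl
  refine ⟨X, X.map (frobenius K p), hX, ?_, fun I hI => Or.inl (hXp I hI)⟩
  intro I hI
  rw [hXp I hI]
  exact pow_ne_zero _ (hX I hI)
end

section
/- Let K be a field of characteristic 2 with more than 2 elements. Then there exist 2×4 matrices X and X₂ over K, both representing the uniform matroid U_{2,4} (i.e. all six 2×2 maximal minors of each are nonzero), such that for every 2-element subset I of the column indices, Δ_I(X₂) = Δ_I(X)² or Δ_I(X₂) = −Δ_I(X)². -/
/-- **Proposition 2.4 (characteristic 2).** Over a field of characteristic `2` with more
than two elements there are `2 × 4` matrices `X` and `X₂`, both representing `U_{2,4}`,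
with `Δ_I(X₂) = ± Δ_I(X)²` for every `2`-element set `I` of column indices. -/
theorem counterexample_char_two {K : Type*} [Field K] [CharP K 2]
    (hK : ∃ x : K, x ≠ 0 ∧ x ≠ 1) :
    ∃ X X₂ : Matrix (Fin 2) (Fin 4) K,
      (∀ I : Finset (Fin 4), I.card = 2 → maxMinor X I ≠ 0) ∧
      (∀ I : Finset (Fin 4), I.card = 2 → maxMinor X₂ I ≠ 0) ∧
      (∀ I : Finset (Fin 4), I.card = 2 →
        maxMinor X₂ I = maxMinor X I ^ 2 ∨ maxMinor X₂ I = -(maxMinor X I ^ 2)) := by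
  obtain ⟨x, hx0, hx1⟩ := hK
  have key : ∀ I : Finset (Fin 4), I.card = 2 →
      maxMinor (!![1, 0, 1, 1; 0, 1, 1, x] : Matrix (Fin 2) (Fin 4) K) I ≠ 0 := by
    intro I h
    have hne : ((I.orderIsoOfFin h) 0).val ≠ ((I.orderIsoOfFin h) 1).val := by
      intro e
      have e2 := (I.orderIsoOfFin h).injective (Subtype.ext e)
      exact absurd e2 (by decide)
    unfold maxMinor
    rw [dif_pos h, Matrix.det_fin_two]
    simp only [Matrix.submatrix_apply, id]
    generalize ((I.orderIsoOfFin h) 0).val = a at *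
    generalize ((I.orderIsoOfFin h) 1).val = b at *
    have h1 : x - 1 ≠ 0 := sub_ne_zero.2 hx1
    have h2 : 1 - x ≠ 0 := sub_ne_zero.2 (Ne.symm hx1)
    fin_cases a <;> fin_cases b <;> simp_all
  have frob : ∀ (X : Matrix (Fin 2) (Fin 4) K) (I : Finset (Fin 4)), I.card = 2 →
      maxMinor (X.map (fun y => y ^ 2)) I = maxMinor X I ^ 2 := by
    intro X I h
    unfold maxMinor
    rw [dif_pos h, dif_pos h, Matrix.det_fin_two, Matrix.det_fin_two, sub_pow_char (p := 2)]
    simp [mul_pow]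
  refine ⟨_, (!![1, 0, 1, 1; 0, 1, 1, x] : Matrix (Fin 2) (Fin 4) K).map (fun y => y ^ 2),
    key, fun I h => ?_, fun I h => Or.inl (frob _ I h)⟩
  rw [frob _ I h]
  exact pow_ne_zero 2 (key I h)
end

section
/- Let k be a negative real number. Then there exist 2×4 real matrices X and X_k such that X represents the uniform matroid U_{2,4} (i.e. all six of its 2×2 maximal minors are nonzero) and for every 2-element subset I of the column indices, |Δ_I(X_k)| = |Δ_I(X)|^k (real power). -/
theorem aux_minor (I : Finset (Fin 4)) (hI : I.card = 2) :
    ∃ i j : Fin 4, i < j ∧ ∀ X : Matrix (Fin 2) (Fin 4) ℝ,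
      maxMinor X I = X 0 i * X 1 j - X 0 j * X 1 i := by
  refine ⟨((I.orderIsoOfFin hI) 0).val, ((I.orderIsoOfFin hI) 1).val, ?_, ?_⟩
  · exact (I.orderIsoOfFin hI).strictMono (by decide)
  · intro X
    rw [maxMinor, dif_pos hI, Matrix.det_fin_two]
    rfl

theorem aux_root (k : ℝ) (hk : k < 0) :
    ∃ t : ℝ, 0 < t ∧ t < 1 ∧ t ^ k - 1 = (1 - t) ^ k := by
  have hh : (0:ℝ) < (1/2 : ℝ) ^ k := by positivity
  obtain ⟨a, ha⟩ : ∃ a : ℝ, a = (1 + (1/2 : ℝ) ^ k) ^ (k⁻¹) := ⟨_, rfl⟩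
  have ha0 : 0 < a := by rw [ha]; positivity
  have hak : a ^ k = 1 + (1/2 : ℝ) ^ k := by
    rw [ha, Real.rpow_inv_rpow (by positivity) hk.ne]
  have ha2 : a ≤ 1/2 := by
    by_contra! h
    have := Real.rpow_lt_rpow_of_neg (by norm_num) h hk
    linarith
  have hc : ContinuousOn (fun t : ℝ => t ^ k - (1 - t) ^ k) (Set.Icc a (1/2)) := by
    apply ContinuousOn.sub
    · apply ContinuousOn.rpow_const continuousOn_id
      intro x hx
      left
      exact (lt_of_lt_of_le ha0 hx.1).ne'
    · apply ContinuousOn.rpow_const (by fun_prop)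
      intro x hx
      left
      have := hx.2
      linarith
  have h1 : (1 - a) ^ k ≤ (1/2 : ℝ) ^ k :=
    Real.rpow_le_rpow_of_nonpos (by norm_num) (by linarith) hk.le
  have hm := intermediate_value_Icc' ha2 hc
  have h3 : (1 - 1/2 : ℝ) = 1/2 := by norm_num
  obtain ⟨t, ht, hte⟩ := hm (show (1:ℝ) ∈ _ from
    ⟨by simp only [h3]; linarith, by simp only [hak]; linarith⟩)
  refine ⟨t, lt_of_lt_of_le ha0 ht.1, by linarith [ht.2], ?_⟩
  simp only at hte
  linarith

/-- **Proposition 2.4 (negative real exponent).** For any negative real `k` there are real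
`2 × 4` matrices `X` and `X_k` such that `X` represents `U_{2,4}` and
`|Δ_I(X_k)| = |Δ_I(X)|^k` (real power) for every `2`-element set `I` of column indices. -/
theorem counterexample_negative_real_exponent (k : ℝ) (hk : k < 0) :
    ∃ X Xk : Matrix (Fin 2) (Fin 4) ℝ,
      (∀ I : Finset (Fin 4), I.card = 2 → maxMinor X I ≠ 0) ∧
      (∀ I : Finset (Fin 4), I.card = 2 → |maxMinor Xk I| = |maxMinor X I| ^ k) := by
  obtain ⟨t, h0, h1, h⟩ := aux_root k hk
  have hp : 0 < t ^ k := by positivity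
  have hq : 0 < (1 - t) ^ k := Real.rpow_pos_of_pos (by linarith) k
  have e1 : |t - 1| = 1 - t := by rw [abs_sub_comm, abs_of_pos (by linarith)]
  have hne : t - 1 ≠ 0 := by linarith
  refine ⟨!![1, 0, 1, 1; 0, 1, 1, t], !![1, 0, 1, 1; 0, 1, 1, t ^ k], ?_, ?_⟩
  · intro I hI
    obtain ⟨i, j, hij, hX⟩ := aux_minor I hI
    rw [hX]
    fin_cases i <;> fin_cases j <;> simp at hij ⊢ <;> first | exact h0.ne' | exact hne
  · intro I hI
    obtain ⟨i, j, hij, hX⟩ := aux_minor I hI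
    rw [hX, hX]
    fin_cases i <;> fin_cases j <;> simp at hij ⊢
    · rw [abs_of_pos hp, abs_of_pos h0]
    · rw [e1, h, abs_of_pos hq]
end
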